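/- arXiv:math/0702105 — 9 statements merged into one kernel-verified Lean document; each statement's English description precedes it below -/
import Mathlib

section
/- Let n ≥ 1 and let y_0, …, y_s (0 ≤ s ≤ n) be linearly independent vectors in ℂ^{n+1}. Let I ⊆ ℂ[x_0,…,x_n] be the ideal generated by all homogeneous polynomials vanishing at each of y_0, …, y_s. Then for every i ≥ 1 and every k ≥ 2i, a homogeneous polynomial g of degree k satisfies ∂^μ g(y_j) = 0 for all j ∈ {0,…,s} and all multi-indices μ with |μ| ≤ i−1 if and only if g belongs to the i-th power I^i; that is, (I^i)_k = I^{(i)}_k whenever k ≥ 2i. -/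
open MvPolynomial

/-- Iterated partial derivative `∂^μ g`. -/
noncomputable def pd {N : ℕ} (μ : Fin N → ℕ) (g : MvPolynomial (Fin N) ℂ) :
    MvPolynomial (Fin N) ℂ :=
  (List.finRange N).foldr (fun i h => (⇑(pderiv i))^[μ i] h) g

/-- `g` vanishes to order `≥ i` at `y`: all partial derivatives of order `≤ i - 1`
vanish at `y`. -/
def vOrd {N : ℕ} (i : ℕ) (y : Fin N → ℂ) (g : MvPolynomial (Fin N) ℂ) : Prop :=
  ∀ μ : Fin N → ℕ, (∑ j, μ j) < i → eval y (pd μ g) = 0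


theorem coeff_iter_pderiv {N : ℕ} (i : Fin N) (n : ℕ) (ν : Fin N →₀ ℕ) :
    ∃ c : ℂ, c ≠ 0 ∧ ∀ h : MvPolynomial (Fin N) ℂ,
      coeff ν ((⇑(pderiv i))^[n] h) = coeff (ν + Finsupp.single i n) h * c := by
  induction n with
  | zero => exact ⟨1, one_ne_zero, fun h => by simp⟩
  | succ n ih =>
    obtain ⟨c, hc, H⟩ := ih
    refine ⟨(((ν + Finsupp.single i n) i : ℂ) + 1) * c,
      mul_ne_zero (Nat.cast_add_one_ne_zero _) hc, fun h => ?_⟩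
    rw [Function.iterate_succ_apply, H, coeff_pderiv, add_assoc, ← Finsupp.single_add, mul_assoc]

theorem coeff_foldr_pderiv {N : ℕ} (μ : Fin N → ℕ) (L : List (Fin N)) : ∀ (ν : Fin N →₀ ℕ),
    ∃ c : ℂ, c ≠ 0 ∧ ∀ h : MvPolynomial (Fin N) ℂ,
      coeff ν (L.foldr (fun i h => (⇑(pderiv i))^[μ i] h) h) =
        coeff (ν + (L.map fun i => Finsupp.single i (μ i)).sum) h * c := by
  induction L with
  | nil => exact fun ν => ⟨1, one_ne_zero, fun h => by simp⟩
  | cons a L ih =>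
    intro ν
    obtain ⟨c, hc, H⟩ := coeff_iter_pderiv a (μ a) ν
    obtain ⟨d, hd, H'⟩ := ih (ν + Finsupp.single a (μ a))
    refine ⟨d * c, mul_ne_zero hd hc, fun h => ?_⟩
    rw [List.foldr_cons, H, H', List.map_cons, List.sum_cons, mul_assoc, add_assoc]

theorem mem_pow_of_vOrd_zero {N : ℕ} (i : ℕ) (f : MvPolynomial (Fin N) ℂ) (hf : vOrd i 0 f) :
    f ∈ idealOfVars (Fin N) ℂ ^ i := by
  rw [mem_pow_idealOfVars_iff']
  intro x hx
  obtain ⟨c, hc, H⟩ := coeff_foldr_pderiv (fun j => x j) (List.finRange N) 0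
  have h1 := hf (fun j => x j) (by rwa [Finsupp.degree_eq_sum] at hx)
  have h2 := H f
  have h3 : ((List.finRange N).map fun i => Finsupp.single i (x i)).sum = x := by
    rw [← List.ofFn_eq_map, List.sum_ofFn]
    exact Finsupp.univ_sum_single x
  rw [h3, zero_add] at h2
  have h4 : coeff 0 (pd (fun j => x j) f) = 0 := by
    rw [← h1, MvPolynomial.eval_zero, constantCoeff_eq]
  unfold pd at h4
  rw [h4] at h2
  exact (mul_eq_zero.mp h2.symm).resolve_right hc

/-- Translation by `y`. -/
noncomputable def transl {N : ℕ} (y : Fin N → ℂ) :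
    MvPolynomial (Fin N) ℂ →ₐ[ℂ] MvPolynomial (Fin N) ℂ :=
  aeval (fun a => X a + C (y a))

theorem pderiv_transl {N : ℕ} (y : Fin N → ℂ) (i : Fin N) (g : MvPolynomial (Fin N) ℂ) :
    pderiv i (transl y g) = transl y (pderiv i g) := by
  induction g using MvPolynomial.induction_on with
  | C a => simp [transl]
  | add p q hp hq => simp [hp, hq]
  | mul_X p a hp =>
    have : pderiv i (transl y (X a)) = transl y (pderiv i (X a)) := by
      by_cases h : a = i
      · subst h; simp [transl]
      · simp [transl, pderiv_X_of_ne h]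
    rw [map_mul, pderiv_mul, pderiv_mul, hp, this, map_add, map_mul, map_mul]

theorem pd_transl {N : ℕ} (y : Fin N → ℂ) (μ : Fin N → ℕ) (g : MvPolynomial (Fin N) ℂ) :
    pd μ (transl y g) = transl y (pd μ g) := by
  unfold pd
  induction List.finRange N with
  | nil => rfl
  | cons a L ih =>
    rw [List.foldr_cons, List.foldr_cons, ih]
    generalize L.foldr (fun i h => (⇑(pderiv i))^[μ i] h) g = h
    induction μ a generalizing h with
    | zero => rfl
    | succ n ihn => rw [Function.iterate_succ_apply, Function.iterate_succ_apply,
        pderiv_transl, ihn]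

theorem eval_zero_transl {N : ℕ} (y : Fin N → ℂ) (g : MvPolynomial (Fin N) ℂ) :
    eval 0 (transl y g) = eval y g := by
  induction g using MvPolynomial.induction_on with
  | C a => simp [transl]
  | add p q hp hq => rw [map_add, map_add, map_add, hp, hq]
  | mul_X p a hp => rw [map_mul, map_mul, map_mul, hp]; simp [transl]

theorem transl_mem {N : ℕ} (i : ℕ) (y : Fin N → ℂ) (g : MvPolynomial (Fin N) ℂ)
    (hg : vOrd i y g) : transl y g ∈ idealOfVars (Fin N) ℂ ^ i := by
  apply mem_pow_of_vOrd_zero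
  intro μ hμ
  rw [pd_transl, eval_zero_transl]
  exact hg μ hμ

/-! ### The easy direction -/

theorem pderiv_mem_pow {N : ℕ} (M : Ideal (MvPolynomial (Fin N) ℂ)) (a : Fin N) (i : ℕ) :
    ∀ g ∈ M ^ (i + 1), pderiv a g ∈ M ^ i := by
  induction i with
  | zero => intro g _; simp
  | succ i ih =>
    intro g hg
    rw [pow_succ] at hg
    refine Submodule.mul_induction_on hg ?_ ?_
    · intro p hp q hq
      rw [pderiv_mul]
      refine add_mem ?_ (Ideal.mul_mem_right _ _ hp)
      rw [pow_succ]
      exact Ideal.mul_mem_mul (ih p hp) hq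
    · intro p q hp hq
      rw [map_add]; exact add_mem hp hq

theorem foldr_mem_pow {N : ℕ} (M : Ideal (MvPolynomial (Fin N) ℂ)) (μ : Fin N → ℕ)
    (L : List (Fin N)) : ∀ (i : ℕ) (g : MvPolynomial (Fin N) ℂ), g ∈ M ^ (i + (L.map μ).sum) →
      L.foldr (fun i h => (⇑(pderiv i))^[μ i] h) g ∈ M ^ i := by
  induction L with
  | nil => intro i g hg; simpa using hg
  | cons a L ih =>
    intro i g hg
    rw [List.map_cons, List.sum_cons, ← add_assoc] at hg
    have := ih _ g hg
    rw [List.foldr_cons]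
    revert this
    generalize L.foldr (fun i h => (⇑(pderiv i))^[μ i] h) g = h
    induction μ a generalizing h with
    | zero => exact id
    | succ n ihn =>
      intro hh
      exact ihn _ (pderiv_mem_pow M a _ h hh)

theorem vOrd_of_mem {N : ℕ} (y : Fin N → ℂ) (M : Ideal (MvPolynomial (Fin N) ℂ))
    (hM : ∀ g ∈ M, eval y g = 0) (i : ℕ) (g : MvPolynomial (Fin N) ℂ) (hg : g ∈ M ^ i) :
    vOrd i y g := by
  intro μ hμ
  apply hM
  rw [← pow_one M]
  apply foldr_mem_pow
  have : ((List.finRange N).map μ).sum = ∑ j, μ j := by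
    rw [← List.ofFn_eq_map, List.sum_ofFn]
  rw [this]
  exact Ideal.pow_le_pow_right (by omega) hg

/-! ### Combinatorics of monomials -/

theorem monomial_mem {A T : Type*} [Fintype A] [Fintype T]
    (J : Ideal (MvPolynomial (A ⊕ T) ℂ))
    (h1 : ∀ c : T, X (Sum.inr c) ∈ J)
    (h2 : ∀ a b : A, a ≠ b → X (Sum.inl a) * X (Sum.inl b) ∈ J) (i : ℕ) :
    ∀ m : (A ⊕ T) →₀ ℕ, 2 * i ≤ m.degree → (∀ a, m (Sum.inl a) + i ≤ m.degree) →
      monomial m (1 : ℂ) ∈ J ^ i := by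
  classical
  induction i with
  | zero => intro m _ _; simp
  | succ i ih =>
    intro m hd hm
    by_cases hc : ∃ c, m (Sum.inr c) ≠ 0
    · obtain ⟨c, hc⟩ := hc
      obtain ⟨m', rfl⟩ : ∃ m', m = m' + Finsupp.single (Sum.inr c) 1 :=
        ⟨m - Finsupp.single (Sum.inr c) 1, (tsub_add_cancel_of_le (by
          rw [Finsupp.single_le_iff]; omega)).symm⟩
      rw [monomial_add_single, pow_one, pow_succ]
      rw [map_add, Finsupp.degree_single] at hd hm
      refine Ideal.mul_mem_mul (ih m' (by omega) fun a => ?_) (h1 c)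
      have := hm a
      simp at this
      omega
    · push Not at hc
      have hsum : m.degree = ∑ a, m (Sum.inl a) := by
        rw [Finsupp.degree_eq_sum, Fintype.sum_sum_type]; simp [hc]
      have hne : Nonempty A := by
        by_contra hA
        rw [not_nonempty_iff] at hA
        rw [hsum] at hd
        simp at hd
      obtain ⟨a, -, ha⟩ := Finset.exists_max_image Finset.univ (fun a => m (Sum.inl a))
        Finset.univ_nonempty
      obtain ⟨b, hba, hb⟩ : ∃ b, b ≠ a ∧ m (Sum.inl b) ≠ 0 := by
        by_contra! H
        have h3 : m.degree = m (Sum.inl a) := by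
          rw [hsum]
          exact Finset.sum_eq_single a (fun b _ hb => H b hb) (by simp)
        have := hm a
        omega
      have hab : m (Sum.inl a) ≠ 0 := by
        have := ha b (Finset.mem_univ _)
        omega
      obtain ⟨m', rfl⟩ : ∃ m', m = m' + (Finsupp.single (Sum.inl a) 1 +
          Finsupp.single (Sum.inl b) 1) :=
        ⟨m - (Finsupp.single (Sum.inl a) 1 + Finsupp.single (Sum.inl b) 1),
          (tsub_add_cancel_of_le (by
          intro x
          by_cases hxa : x = Sum.inl a
          · subst hxa
            simp [hba]; omega
          by_cases hxb : x = Sum.inl b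
          · subst hxb
            simp [hba.symm]; omega
          simp [Finsupp.single_apply, Ne.symm hxa, Ne.symm hxb])).symm⟩
      have hmon : monomial (m' + (Finsupp.single (Sum.inl a) 1 +
          Finsupp.single (Sum.inl b) 1)) (1 : ℂ) =
          monomial m' 1 * (X (Sum.inl a) * X (Sum.inl b)) := by
        rw [← add_assoc, monomial_add_single, monomial_add_single, pow_one, pow_one, mul_assoc]
      rw [hmon, pow_succ]
      refine Ideal.mul_mem_mul (ih m' ?_ fun j => ?_) (h2 a b hba.symm)
      · simp only [map_add, Finsupp.degree_single] at hd; omega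
      have hma := hm a
      have hmb := hm b
      have hmj := hm j
      have haj := ha j (Finset.mem_univ _)
      by_cases hja : j = a
      · subst hja
        simp [hba] at hma hd
        omega
      by_cases hjb : j = b
      · subst hjb
        simp [hba.symm] at hmb hd
        omega
      have h3 : ∑ x ∈ ({a, b, j} : Finset A), (m' + (Finsupp.single (Sum.inl a) 1 +
          Finsupp.single (Sum.inl b) 1) : (A ⊕ T) →₀ ℕ) (Sum.inl x) ≤ (m' + (Finsupp.single (Sum.inl a) 1 +
          Finsupp.single (Sum.inl b) 1) : (A ⊕ T) →₀ ℕ).degree := by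
        rw [hsum]
        exact Finset.sum_le_sum_of_subset (Finset.subset_univ _)
      rw [Finset.sum_insert (by simp [hba.symm, Ne.symm hja]),
        Finset.sum_insert (by simp [Ne.symm hjb]), Finset.sum_singleton] at h3
      simp [hba, hba.symm, Ne.symm hja, Ne.symm hjb] at h3 haj hd hmj
      omega

/-- Dehomogenization. -/
noncomputable def dehom {ι : Type*} [DecidableEq ι] (j : ι) :
    MvPolynomial ι ℂ →ₐ[ℂ] MvPolynomial ι ℂ :=
  aeval (fun l => if l = j then 1 else X l)

theorem dehom_monomial {ι : Type*} [DecidableEq ι] (j : ι) (m : ι →₀ ℕ) (c : ℂ) :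
    dehom j (monomial m c) = monomial (m.erase j) c := by
  rw [dehom, aeval_monomial, monomial_eq, algebraMap_eq]
  congr 1
  rw [Finsupp.prod, Finsupp.prod, Finsupp.support_erase]
  rw [← Finset.prod_subset (Finset.erase_subset j m.support)]
  · refine Finset.prod_congr rfl fun x hx => ?_
    rw [if_neg (Finset.ne_of_mem_erase hx), Finsupp.erase_ne (Finset.ne_of_mem_erase hx)]
  · intro x hx hx'
    have : x = j := by
      by_contra h
      exact hx' (Finset.mem_erase.mpr ⟨h, hx⟩)
    simp [this]

theorem degree_erase_add {ι : Type*} [DecidableEq ι] (j : ι) (m : ι →₀ ℕ) :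
    m j + (m.erase j).degree = m.degree := by
  conv_rhs => rw [← Finsupp.single_add_erase j m]
  rw [map_add, Finsupp.degree_single]

theorem coeff_dehom {ι : Type*} [DecidableEq ι] (j : ι) (f : MvPolynomial ι ℂ) (k : ℕ)
    (hf : ∀ m ∈ f.support, m.degree = k) (m : ι →₀ ℕ) (hm : m ∈ f.support) :
    coeff (m.erase j) (dehom j f) = coeff m f := by
  conv_lhs => rw [f.as_sum, map_sum, coeff_sum]
  rw [Finset.sum_eq_single m]
  · rw [dehom_monomial, coeff_monomial, if_pos rfl]
  · intro m' hm' hne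
    rw [dehom_monomial, coeff_monomial, if_neg]
    intro he
    apply hne
    have e1 := degree_erase_add j m
    have e2 := degree_erase_add j m'
    rw [hf m hm] at e1
    rw [hf m' hm', he] at e2
    rw [← Finsupp.single_add_erase j m, ← Finsupp.single_add_erase j m', he,
      show m' j = m j by omega]
  · intro h; exact absurd hm h

theorem hard_dir {n s : ℕ} {T : Type*} [Fintype T]
    (b : Module.Basis (Fin (s + 1) ⊕ T) ℂ (Fin (n + 1) → ℂ))
    (y : Fin (s + 1) → (Fin (n + 1) → ℂ)) (hb : ∀ j, b (Sum.inl j) = y j)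
    (I : Ideal (MvPolynomial (Fin (n + 1)) ℂ))
    (hI : I = Ideal.span { g | (∃ k, g.IsHomogeneous k) ∧ ∀ j, eval (y j) g = 0 })
    (i k : ℕ) (hk : 2 * i ≤ k)
    (g : MvPolynomial (Fin (n + 1)) ℂ) (hg : g.IsHomogeneous k)
    (hv : ∀ j, vOrd i (y j) g) : g ∈ I ^ i := by
  classical
  let φ : MvPolynomial (Fin (n + 1)) ℂ →ₐ[ℂ] MvPolynomial (Fin (s + 1) ⊕ T) ℂ :=
    aeval (fun a => ∑ l, C (b l a) * X l)
  let φ' : MvPolynomial (Fin (s + 1) ⊕ T) ℂ →ₐ[ℂ] MvPolynomial (Fin (n + 1)) ℂ :=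
    aeval (fun l => ∑ a, C (b.repr (Pi.single a 1) l) * X a)
  have hinv : ∀ p, φ' (φ p) = p := by
    intro p
    have : φ'.comp φ = AlgHom.id ℂ _ := by
      ext1 a
      have key : ∀ c, ∑ l, b l a * b.repr (Pi.single c 1) l =
          (Pi.single c 1 : Fin (n + 1) → ℂ) a := by
        intro c
        conv_rhs => rw [← b.sum_repr (Pi.single c 1)]
        simp [Finset.sum_apply, mul_comm]
      simp only [φ, φ', AlgHom.comp_apply, aeval_X, map_sum, map_mul, AlgHom.id_apply,
        algHom_C, algebraMap_eq, Finset.mul_sum]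
      rw [Finset.sum_comm]
      simp only [← mul_assoc, ← C_mul, ← Finset.sum_mul, ← map_sum, key]
      rw [Finset.sum_eq_single a]
      · simp
      · intro c _ hc
        simp [Pi.single_apply, hc.symm]
      · simp
    exact DFunLike.congr_fun this p
  have hhom : (φ g).IsHomogeneous k := by
    have := hg.aeval (fun a => ∑ l, C (b l a) * X l) (n := 1) (fun a => by
      refine IsHomogeneous.sum _ _ _ fun l _ => ?_
      exact isHomogeneous_C_mul_X _ _)
    rw [one_mul] at this
    exact this
  have hdeg : ∀ m ∈ (φ g).support, m.degree = k := by
    intro m hm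
    have := hhom (mem_support_iff.mp hm)
    rw [Finsupp.degree_eq_weight_one]
    exact this
  have hcond : ∀ m ∈ (φ g).support, ∀ j, m (Sum.inl j) + i ≤ m.degree := by
    intro m hm j
    have h1 := transl_mem i (y j) g (hv j)
    let θ : MvPolynomial (Fin (n + 1)) ℂ →ₐ[ℂ] MvPolynomial (Fin (s + 1) ⊕ T) ℂ :=
      aeval (fun a => ∑ l ∈ Finset.univ.erase (Sum.inl j), C (b l a) * X l)
    have h2 : dehom (Sum.inl j) (φ g) = θ (transl (y j) g) := by
      have : (dehom (Sum.inl j)).comp φ = θ.comp (transl (y j)) := by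
        ext1 a
        simp only [φ, θ, dehom, transl, AlgHom.comp_apply, aeval_X, map_sum, map_mul, map_add,
          algHom_C, algebraMap_eq]
        rw [← Finset.sum_erase_add _ _ (Finset.mem_univ (Sum.inl j))]
        congr 1
        · refine Finset.sum_congr rfl fun l hl => ?_
          rw [if_neg (Finset.ne_of_mem_erase hl)]
        · simp [hb]
      exact DFunLike.congr_fun this g
    have h3 : θ (transl (y j) g) ∈ idealOfVars (Fin (s + 1) ⊕ T) ℂ ^ i := by
      have hle : (idealOfVars (Fin (n + 1)) ℂ).map θ ≤ idealOfVars (Fin (s + 1) ⊕ T) ℂ := by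
        rw [idealOfVars, Ideal.map_span, Ideal.span_le]
        rintro _ ⟨_, ⟨a, rfl⟩, rfl⟩
        simp only [θ, aeval_X, SetLike.mem_coe]
        exact sum_mem fun l _ => Ideal.mul_mem_left _ _ (Ideal.subset_span ⟨l, rfl⟩)
      have h4 := Ideal.mem_map_of_mem θ h1
      rw [Ideal.map_pow] at h4
      exact Ideal.pow_right_mono hle i h4
    rw [← h2, mem_pow_idealOfVars_iff] at h3
    have h5 := h3 (m.erase (Sum.inl j)) (by
      rw [mem_support_iff, coeff_dehom _ _ k hdeg m hm]
      exact mem_support_iff.mp hm)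
    have h6 := degree_erase_add (Sum.inl j) m
    omega
  have hev : ∀ j l, eval (y j) (φ' (X l)) = if l = Sum.inl j then 1 else 0 := by
    intro j l
    have h1 : eval (y j) (φ' (X l)) = b.repr (y j) l := by
      simp only [φ', aeval_X, map_sum, map_mul, eval_C, eval_X]
      conv_rhs => rw [← Finset.univ_sum_single (y j)]
      simp only [map_sum, Finsupp.coe_finsetSum, Finset.sum_apply]
      refine Finset.sum_congr rfl fun a _ => ?_
      have : (Pi.single a (y j a) : Fin (n + 1) → ℂ) = y j a • Pi.single a 1 := by
        rw [← Pi.single_smul]; simp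
      rw [this, map_smul]
      simp [mul_comm]
    rw [h1, ← hb, b.repr_self, Finsupp.single_apply]
    simp [eq_comm]
  have hlin : ∀ l, (φ' (X l)).IsHomogeneous 1 := by
    intro l
    simp only [φ', aeval_X]
    exact IsHomogeneous.sum _ _ _ fun l _ => isHomogeneous_C_mul_X _ _
  have hmem : φ g ∈ (I.comap φ') ^ i := by
    rw [(φ g).as_sum]
    refine sum_mem fun m hm => ?_
    have h0 : monomial m (coeff m (φ g)) = C (coeff m (φ g)) * monomial m 1 := by
      rw [C_mul_monomial, mul_one]
    rw [h0]
    refine Ideal.mul_mem_left _ _ (monomial_mem _ ?_ ?_ i m (by rw [hdeg m hm]; exact hk)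
      (hcond m hm))
    · intro c
      rw [Ideal.mem_comap, hI]
      refine Ideal.subset_span ⟨⟨1, hlin _⟩, fun j => ?_⟩
      rw [hev]; simp
    · intro a c hac
      rw [Ideal.mem_comap, hI, map_mul]
      refine Ideal.subset_span ⟨⟨2, (hlin _).mul (hlin _)⟩, fun j => ?_⟩
      rw [map_mul, hev, hev]
      by_cases h : a = j
      · subst h
        simp [hac.symm]
      · simp [h]
  have h7 := Ideal.mem_map_of_mem φ' hmem
  rw [hinv, Ideal.map_pow] at h7
  exact Ideal.pow_right_mono Ideal.map_comap_le i h7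

/-- Lemma 2.5:  for linearly independent points `y_0, …, y_s` in `ℂ^{n+1}`,
`(I^i)_k = I^{(i)}_k` whenever `k ≥ 2i`, where `I` is the ideal generated by the
homogeneous polynomials vanishing at all the points. -/
theorem stmt0 (n s : ℕ) (hn : 1 ≤ n) (hs : s ≤ n)
    (y : Fin (s + 1) → (Fin (n + 1) → ℂ)) (hli : LinearIndependent ℂ y)
    (I : Ideal (MvPolynomial (Fin (n + 1)) ℂ))
    (hI : I = Ideal.span { g | (∃ k, g.IsHomogeneous k) ∧ ∀ j, eval (y j) g = 0 })
    (i k : ℕ) (hi : 1 ≤ i) (hk : 2 * i ≤ k)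
    (g : MvPolynomial (Fin (n + 1)) ℂ) (hg : g.IsHomogeneous k) :
    (∀ j, vOrd i (y j) g) ↔ g ∈ I ^ i := by
  
  classical
  constructor
  swap
  · intro h j
    refine vOrd_of_mem (y j) I ?_ i g h
    intro p hp
    have : I ≤ RingHom.ker (eval (y j)) := by
      rw [hI, Ideal.span_le]
      intro q hq
      exact hq.2 j
    exact this hp
  intro hv
  let b := Module.Basis.sumExtend hli
  have hb : ∀ j, b (Sum.inl j) = y j := by
    intro j
    simp only [b, Module.Basis.sumExtend, Module.Basis.reindex_apply, Equiv.symm_symm,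
      Module.Basis.extend_apply_self]
    rfl
  have : Fintype (Fin (s + 1) ⊕ Module.Basis.sumExtendIndex hli) :=
    FiniteDimensional.fintypeBasisIndex b
  have : Fintype (Module.Basis.sumExtendIndex hli) :=
    Fintype.ofInjective (Sum.inr : _ → Fin (s + 1) ⊕ Module.Basis.sumExtendIndex hli)
      Sum.inr_injective
  exact hard_dir b y hb I hI i k hk g hg hv
end

section
/- Let f ∈ ℂ[x_0,…,x_n] (n ≥ 2) be homogeneous of degree d ≥ 2 such that every singular point of the hypersurface Y = {f = 0} ⊂ ℙ^n(ℂ) is an ordinary double point, and let S ⊂ ℂ^{n+1}∖{0} be a set of pairwise non-proportional representatives of the singular points (a finite set). Let i ≥ 0 and k ≥ i be integers and set e = k − i(d−1), and assume e ≥ 0. Suppose that for every y ∈ S there exists a homogeneous polynomial g_{(y)} of degree e with g_{(y)}(y) ≠ 0 and g_{(y)}(y') = 0 for every y' ∈ S∖{y}. Then the order-i jet map on I^{(i)}_k is surjective; concretely: for every family (h_y)_{y∈S} of homogeneous polynomials of degree k such that each h_y vanishes to order ≥ i at y, there exists g ∈ I^{(i)}_k (i.e. g homogeneous of degree k vanishing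 to order ≥ i at every point of S) such that g − h_y vanishes to order ≥ i+1 at y, for every y ∈ S. -/
open MvPolynomial

/-- The Hessian matrix of `f` at `y`. -/
noncomputable def hess {N : ℕ} (f : MvPolynomial (Fin N) ℂ) (y : Fin N → ℂ) :
    Matrix (Fin N) (Fin N) ℂ :=
  Matrix.of fun i j => eval y (pderiv i (pderiv j f))


noncomputable def trl {N : ℕ} (y : Fin N → ℂ) :
    MvPolynomial (Fin N) ℂ →ₐ[ℂ] MvPolynomial (Fin N) ℂ :=
  aeval (fun j => X j + C (y j))

lemma trl_pderiv {N : ℕ} (y : Fin N → ℂ) (j : Fin N) (p : MvPolynomial (Fin N) ℂ) :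
    trl y (pderiv j p) = pderiv j (trl y p) := by
  induction p using MvPolynomial.induction_on with
  | C a => simp [trl]
  | add p q hp hq => simp [hp, hq]
  | mul_X p l hp =>
    have h1 : trl y (X l) = X l + C (y l) := by simp [trl]
    rw [map_mul (trl y), Derivation.leibniz, Derivation.leibniz, h1]
    simp only [smul_eq_mul, map_add, map_mul, hp, h1, pderiv_C, add_zero]
    by_cases hl : l = j
    · subst hl; simp
    · simp [pderiv_X_of_ne hl]

lemma constCoeff_trl {N : ℕ} (y : Fin N → ℂ) (p : MvPolynomial (Fin N) ℂ) :
    coeff 0 (trl y p) = eval y p := by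
  induction p using MvPolynomial.induction_on with
  | C a => simp [trl]
  | add p q hp hq => simp [hp, hq]
  | mul_X p l hp =>
    have h1 : trl y (X l) = X l + C (y l) := by simp [trl]
    rw [map_mul, h1, mul_add, coeff_add, mul_comm _ (C _), coeff_C_mul, hp]
    rw [show coeff 0 (trl y p * X l) = 0 by simp [coeff_mul_X']]
    simp [mul_comm]

lemma trl_pd {N : ℕ} (y : Fin N → ℂ) (μ : Fin N → ℕ) (p : MvPolynomial (Fin N) ℂ) :
    trl y (pd μ p) = pd μ (trl y p) := by
  unfold pd
  induction List.finRange N with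
  | nil => simp
  | cons a l ih =>
    simp only [List.foldr_cons]
    rw [← ih]
    generalize List.foldr _ p l = q
    generalize μ a = m
    induction m with
    | zero => rfl
    | succ m ihm => rw [Function.iterate_succ_apply', Function.iterate_succ_apply', trl_pderiv, ihm]

lemma coeff_iter {N : ℕ} (a : Fin N) (m : ℕ) (s : Fin N →₀ ℕ) :
    ∃ c : ℂ, c ≠ 0 ∧ ∀ p : MvPolynomial (Fin N) ℂ,
      coeff s ((⇑(pderiv a))^[m] p) = c * coeff (s + Finsupp.single a m) p := by
  induction m generalizing s with
  | zero => exact ⟨1, one_ne_zero, by simp⟩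
  | succ m ih =>
    obtain ⟨c, hc, h⟩ := ih (s + Finsupp.single a 1)
    refine ⟨c * (s a + 1), mul_ne_zero hc (Nat.cast_add_one_ne_zero (s a)), fun p => ?_⟩
    rw [Function.iterate_succ_apply', coeff_pderiv, h, add_assoc, ← Finsupp.single_add,
      add_comm 1 m]
    ring

lemma coeff_pd {N : ℕ} (μ : Fin N → ℕ) :
    ∃ c : ℂ, c ≠ 0 ∧ ∀ p : MvPolynomial (Fin N) ℂ,
      coeff 0 (pd μ p) = c * coeff (Finsupp.equivFunOnFinite.symm μ) p := by
  have key : ∀ (l : List (Fin N)) (s : Fin N →₀ ℕ), ∃ c : ℂ, c ≠ 0 ∧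
      ∀ p : MvPolynomial (Fin N) ℂ,
      coeff s (l.foldr (fun i h => (⇑(pderiv i))^[μ i] h) p) =
        c * coeff (s + (l.map (fun i => Finsupp.single i (μ i))).sum) p := by
    intro l
    induction l with
    | nil => intro s; exact ⟨1, one_ne_zero, by simp⟩
    | cons a l ih =>
      intro s
      obtain ⟨c, hc, h⟩ := coeff_iter a (μ a) s
      obtain ⟨c', hc', h'⟩ := ih (s + Finsupp.single a (μ a))
      refine ⟨c * c', mul_ne_zero hc hc', fun p => ?_⟩
      simp only [List.foldr_cons, List.map_cons, List.sum_cons]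
      rw [h, h', add_assoc, mul_assoc]
  obtain ⟨c, hc, h⟩ := key (List.finRange N) 0
  refine ⟨c, hc, fun p => ?_⟩
  have : (0 + ((List.finRange N).map (fun i => Finsupp.single i (μ i))).sum) =
      Finsupp.equivFunOnFinite.symm μ := by
    rw [zero_add, ← Fin.sum_univ_def]
    ext j
    simp [Finsupp.finsetSum_apply, Finsupp.single_apply]
  rw [← this]
  exact h p

lemma vOrd_iff {N : ℕ} (i : ℕ) (y : Fin N → ℂ) (g : MvPolynomial (Fin N) ℂ) :
    vOrd i y g ↔ trl y g ∈ idealOfVars (Fin N) ℂ ^ i := by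
  rw [mem_pow_idealOfVars_iff']
  constructor
  · intro h s hs
    obtain ⟨c, hc, hp⟩ := coeff_pd (N := N) s
    have h1 := h s (by rwa [Finsupp.degree_eq_sum] at hs)
    rw [← constCoeff_trl, trl_pd, hp] at h1
    have := (mul_eq_zero.1 h1).resolve_left hc
    simpa using this
  · intro h μ hμ
    obtain ⟨c, hc, hp⟩ := coeff_pd (N := N) μ
    rw [← constCoeff_trl, trl_pd, hp, h _ (by rw [Finsupp.degree_eq_sum]; simpa using hμ), mul_zero]

lemma pderiv_mem {N : ℕ} (m : ℕ) (j : Fin N) (p : MvPolynomial (Fin N) ℂ)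
    (hp : p ∈ idealOfVars (Fin N) ℂ ^ (m + 1)) : pderiv j p ∈ idealOfVars (Fin N) ℂ ^ m := by
  rw [mem_pow_idealOfVars_iff'] at *
  intro s hs
  rw [coeff_pderiv, hp _ (by simpa using hs), zero_mul]

lemma homog_mem {N : ℕ} (m : ℕ) (p : MvPolynomial (Fin N) ℂ)
    (hp : p.IsHomogeneous m) : p ∈ idealOfVars (Fin N) ℂ ^ m := by
  rw [mem_pow_idealOfVars_iff']
  intro s hs
  exact hp.coeff_eq_zero hs.ne

lemma homog_zero {N : ℕ} (m : ℕ) (p : MvPolynomial (Fin N) ℂ)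
    (hp : p.IsHomogeneous m) (h : p ∈ idealOfVars (Fin N) ℂ ^ (m + 1)) : p = 0 := by
  rw [mem_pow_idealOfVars_iff'] at h
  ext s
  by_cases hs : s.degree = m
  · simpa using h s (by omega)
  · simpa using hp.coeff_eq_zero hs

lemma sub_comp_mem {N : ℕ} (m : ℕ) (p : MvPolynomial (Fin N) ℂ)
    (h : p ∈ idealOfVars (Fin N) ℂ ^ m) :
    p - homogeneousComponent m p ∈ idealOfVars (Fin N) ℂ ^ (m + 1) := by
  rw [mem_pow_idealOfVars_iff'] at *
  intro s hs
  rw [coeff_sub, coeff_homogeneousComponent]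
  split_ifs with h1
  · simp
  · rw [h s (by omega), sub_zero]

lemma aeval_sub_mem {N M : ℕ} (a b : Fin M → MvPolynomial (Fin N) ℂ)
    (hb : ∀ j, b j ∈ idealOfVars (Fin N) ℂ)
    (hab : ∀ j, a j - b j ∈ idealOfVars (Fin N) ℂ ^ 2)
    (m : ℕ) (P : MvPolynomial (Fin M) ℂ) (hP : P.IsHomogeneous m) :
    aeval a P - aeval b P ∈ idealOfVars (Fin N) ℂ ^ (m + 1) := by
  set I := idealOfVars (Fin N) ℂ
  have ha : ∀ j, a j ∈ I := fun j => by
    have := I.add_mem (Ideal.pow_le_self two_ne_zero (hab j)) (hb j)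
    simpa using this
  have hmul : ∀ (m n : ℕ) (p q : MvPolynomial (Fin M) ℂ),
      (aeval b p ∈ I ^ m ∧ aeval a p - aeval b p ∈ I ^ (m + 1)) →
      (aeval b q ∈ I ^ n ∧ aeval a q - aeval b q ∈ I ^ (n + 1)) →
      (aeval b (p * q) ∈ I ^ (m + n) ∧
        aeval a (p * q) - aeval b (p * q) ∈ I ^ (m + n + 1)) := by
    rintro m n p q ⟨h1, h2⟩ ⟨h3, h4⟩
    have h5 : aeval a q ∈ I ^ n := by
      have := (I ^ n).add_mem (Ideal.pow_le_pow_right (Nat.le_succ n) h4) h3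
      simpa using this
    refine ⟨?_, ?_⟩
    · rw [map_mul, pow_add]; exact Ideal.mul_mem_mul h1 h3
    · have e : aeval a (p * q) - aeval b (p * q) =
          (aeval a p - aeval b p) * aeval a q + aeval b p * (aeval a q - aeval b q) := by
        rw [map_mul, map_mul]; ring
      rw [e]
      refine Ideal.add_mem _ ?_ ?_
      · rw [show m + n + 1 = (m + 1) + n by ring, pow_add]; exact Ideal.mul_mem_mul h2 h5
      · rw [add_assoc, pow_add]; exact Ideal.mul_mem_mul h1 h4
  have key : ∀ s : Fin M →₀ ℕ, aeval b (monomial s (1 : ℂ)) ∈ I ^ s.degree ∧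
      aeval a (monomial s (1 : ℂ)) - aeval b (monomial s (1 : ℂ)) ∈ I ^ (s.degree + 1) := by
    intro s
    induction s using Finsupp.induction_linear with
    | zero => simp [aeval_monomial]
    | add s t hs ht =>
      have := hmul _ _ _ _ hs ht
      rwa [monomial_mul, mul_one, ← map_add] at this
    | single j r =>
      rw [← X_pow_eq_monomial, Finsupp.degree_single]
      induction r with
      | zero => simp
      | succ r ih =>
        rw [pow_succ]
        exact hmul r 1 _ (X j) ih ⟨by simpa using hb j, by simpa using hab j⟩
  rw [P.as_sum, map_sum, map_sum, ← Finset.sum_sub_distrib]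
  refine Ideal.sum_mem _ fun s hs => ?_
  have h1 := (key s).2
  have h2 := (hmul 0 _ (C (coeff s P)) _ ⟨by simp, by simp [algHom_C]⟩ (key s)).2
  rw [C_mul_monomial, mul_one, zero_add] at h2
  rwa [hP.degree_eq_sum_deg_support hs] 

lemma deriv_line {N : ℕ} (u y : Fin N → ℂ) (H : MvPolynomial (Fin N) ℂ) :
    Polynomial.derivative
      (aeval (fun j => Polynomial.C (u j) + Polynomial.X * Polynomial.C (y j)) H) =
    ∑ j, aeval (fun j => Polynomial.C (u j) + Polynomial.X * Polynomial.C (y j))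
      (C (y j) * pderiv j H) := by
  set v : Fin N → Polynomial ℂ :=
    fun j => Polynomial.C (u j) + Polynomial.X * Polynomial.C (y j) with hv
  induction H using MvPolynomial.induction_on with
  | C a => simp
  | add p q hp hq =>
    simp only [map_add, hp, hq, mul_add, Finset.sum_add_distrib]
  | mul_X p l hp =>
    have h1 : Polynomial.derivative (v l) = Polynomial.C (y l) := by simp [hv]
    rw [map_mul, aeval_X, Polynomial.derivative_mul, hp, h1]
    have h2 : ∀ j, aeval v (C (y j) * pderiv j (p * X l)) =
        aeval v (C (y j) * pderiv j p) * v l +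
          if l = j then aeval v p * Polynomial.C (y j) else 0 := by
      intro j
      rw [Derivation.leibniz]
      by_cases hl : l = j
      · subst hl
        simp only [pderiv_X_self, smul_eq_mul, map_mul, map_add, aeval_X, if_true, algHom_C,
          mul_one, Polynomial.algebraMap_eq]
        ring
      · simp only [pderiv_X_of_ne hl, smul_eq_mul, map_mul, map_add, aeval_X, if_neg hl,
          mul_zero, zero_add, add_zero]
        ring
    simp only [h2, Finset.sum_add_distrib, Finset.sum_mul]
    simp

lemma line_const {N : ℕ} (y : Fin N → ℂ) (H : MvPolynomial (Fin N) ℂ)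
    (hH : ∑ j, C (y j) * pderiv j H = 0) (u : Fin N → ℂ) (c : ℂ) :
    eval (u + c • y) H = eval u H := by
  have h1 := deriv_line u y H
  rw [← map_sum, hH, map_zero] at h1
  have h2 := Polynomial.eq_C_of_derivative_eq_zero h1
  set q := aeval (fun j => Polynomial.C (u j) + Polynomial.X * Polynomial.C (y j)) H with hq
  have h3 : ∀ t : ℂ, q.eval t = eval (u + t • y) H := by
    intro t
    rw [hq]
    clear_value q
    clear hq h1 h2 hH
    induction H using MvPolynomial.induction_on with
    | C a => simp
    | add p q hp hq => simp only [map_add, Polynomial.eval_add, hp, hq]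
    | mul_X p l hp =>
      simp only [map_mul, Polynomial.eval_mul, hp, aeval_X, eval_X]
      simp [mul_comm t]
  have h4 := h3 0
  rw [zero_smul, add_zero] at h4
  rw [← h3, ← h4, h2]; simp

lemma exists_left {N : ℕ} (A : Matrix (Fin (N + 1)) (Fin (N + 1)) ℂ) (y : Fin (N + 1) → ℂ)
    (hy : y ≠ 0) (hA : A.rank = N) (hAy : A.mulVec y = 0) :
    ∃ (B : Matrix (Fin (N + 1)) (Fin (N + 1)) ℂ), ∀ u, ∃ c : ℂ,
      B.mulVec (A.mulVec u) = u + c • y := by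
  let F := A.mulVecLin
  have hk : Module.finrank ℂ (LinearMap.ker F) = 1 := by
    have h1 := F.finrank_range_add_finrank_ker
    have h2 : Module.finrank ℂ (LinearMap.range F) = N := hA
    simp at h1
    omega
  have hys : ∀ w, F w = 0 → ∃ c : ℂ, c • y = w := by
    intro w hw
    obtain ⟨c, hc⟩ := (finrank_eq_one_iff_of_nonzero' (K := ℂ)
      (⟨y, hAy⟩ : LinearMap.ker F) (by simpa [Subtype.ext_iff] using hy)).1 hk ⟨w, hw⟩
    exact ⟨c, by simpa [Subtype.ext_iff] using hc⟩
  obtain ⟨s, hs⟩ := F.rangeRestrict.exists_rightInverse_of_surjective F.range_rangeRestrict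
  obtain ⟨G, hG⟩ := s.exists_extend
  refine ⟨LinearMap.toMatrix' G, fun u => ?_⟩
  have h1 : G (F u) = s (F.rangeRestrict u) := by
    rw [← hG]; rfl
  have h2 : F (s (F.rangeRestrict u)) = F u := by
    have := LinearMap.congr_fun hs (F.rangeRestrict u)
    exact congrArg Subtype.val this
  obtain ⟨c, hc⟩ := hys (G (F u) - u) (by rw [map_sub, h1, h2, sub_self])
  refine ⟨c, ?_⟩
  rw [hc, LinearMap.toMatrix'_mulVec]
  change G (F u) = _
  abel

lemma exists_P {N : ℕ} (A : Matrix (Fin (N + 1)) (Fin (N + 1)) ℂ) (y : Fin (N + 1) → ℂ)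
    (hy : y ≠ 0) (hA : A.rank = N) (hAy : A.mulVec y = 0) (i : ℕ)
    (H : MvPolynomial (Fin (N + 1)) ℂ) (hHh : H.IsHomogeneous i)
    (hH : ∑ j, C (y j) * pderiv j H = 0) :
    ∃ P : MvPolynomial (Fin (N + 1)) ℂ, P.IsHomogeneous i ∧
      aeval (fun j => ∑ l, C (A j l) * X l : Fin (N + 1) → MvPolynomial (Fin (N + 1)) ℂ) P = H := by
  obtain ⟨B, hB⟩ := exists_left A y hy hA hAy
  refine ⟨aeval (fun j => ∑ l, C (B j l) * X l : Fin (N + 1) → MvPolynomial (Fin (N + 1)) ℂ) H,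
    ?_, ?_⟩
  · have := hHh.aeval (fun j => ∑ l, C (B j l) * X l : Fin (N + 1) → MvPolynomial (Fin (N + 1)) ℂ)
      (n := 1) (fun j => IsHomogeneous.sum _ _ _ fun l _ => isHomogeneous_C_mul_X _ _)
    simpa using this
  · have ev : ∀ (M : Matrix (Fin (N + 1)) (Fin (N + 1)) ℂ) (p : MvPolynomial (Fin (N + 1)) ℂ) u,
        eval u (aeval (fun j => ∑ l, C (M j l) * X l :
          Fin (N + 1) → MvPolynomial (Fin (N + 1)) ℂ) p) = eval (M.mulVec u) p := by
      intro M p u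
      induction p using MvPolynomial.induction_on with
      | C a => simp
      | add p q hp hq => simp only [map_add, hp, hq]
      | mul_X p l hp => simp only [map_mul, hp, aeval_X, eval_X]; simp [Matrix.mulVec, dotProduct]
    apply MvPolynomial.funext
    intro u
    rw [ev, ev]
    obtain ⟨c, hc⟩ := hB u
    rw [hc, line_const y H hH]

lemma euler_lead {N : ℕ} (y : Fin N → ℂ) (i k : ℕ) (h : MvPolynomial (Fin N) ℂ)
    (hk : h.IsHomogeneous k) (hv : trl y h ∈ idealOfVars (Fin N) ℂ ^ i) :
    ∑ j, C (y j) * pderiv j (homogeneousComponent i (trl y h)) = 0 := by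
  obtain _ | i := i
  · simp [homogeneousComponent_zero]
  set p := trl y h with hp
  set H := homogeneousComponent (i + 1) p with hH
  have hHh : H.IsHomogeneous (i + 1) := homogeneousComponent_isHomogeneous _ _
  have hr := sub_comp_mem _ _ hv
  rw [← hH] at hr
  have he := congrArg (trl y) hk.sum_X_mul_pderiv
  have hX : ∀ j, trl y (X j) = X j + C (y j) := fun j => by simp [trl]
  simp only [map_sum, map_mul, hX, trl_pderiv, ← hp, map_nsmul, add_mul,
    Finset.sum_add_distrib] at he
  refine homog_zero i _ (IsHomogeneous.sum _ _ _ fun j _ => (hHh.pderiv).C_mul _) ?_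
  have e : ∑ j, C (y j) * pderiv j H = k • p - ∑ j, X j * pderiv j p
      - ∑ j, C (y j) * pderiv j (p - H) := by
    rw [← he]
    simp only [map_sub, mul_sub, Finset.sum_sub_distrib]
    ring
  rw [e]
  refine Ideal.sub_mem _ (Ideal.sub_mem _ (nsmul_mem hv _) ?_) ?_
  · refine Ideal.sum_mem _ fun j _ => ?_
    rw [pow_succ']
    refine Ideal.mul_mem_mul ?_ (pderiv_mem _ _ _ hv)
    simpa using homog_mem 1 _ (isHomogeneous_X ℂ j)
  · exact Ideal.sum_mem _ fun j _ => Ideal.mul_mem_left _ _ (pderiv_mem _ _ _ hr)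

lemma lin_part {N : ℕ} (y : Fin N → ℂ) (p : MvPolynomial (Fin N) ℂ) (hp : eval y p = 0) :
    trl y p - ∑ l, C (eval y (pderiv l p)) * X l ∈ idealOfVars (Fin N) ℂ ^ 2 := by
  have h1 : trl y p ∈ idealOfVars (Fin N) ℂ ^ 1 := by
    rw [mem_pow_idealOfVars_iff']
    intro s hs
    have : s = 0 := by rw [← Finsupp.degree_eq_zero_iff]; omega
    rw [this, constCoeff_trl, hp]
  have h2 := sub_comp_mem _ _ h1
  convert h2 using 2
  ext s
  rw [coeff_homogeneousComponent, coeff_sum]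
  simp only [coeff_C_mul, coeff_X]
  split_ifs with hs
  · obtain ⟨a, rfl⟩ : ∃ a, s = Finsupp.single a 1 := by
      have hne : s ≠ 0 := by rintro rfl; simp at hs
      obtain ⟨a, ha⟩ := Finsupp.ne_iff.1 hne
      have hle : Finsupp.single a 1 ≤ s := by
        rw [Finsupp.single_le_iff]
        exact Nat.one_le_iff_ne_zero.2 ha
      obtain ⟨t, rfl⟩ := exists_add_of_le hle
      have ht : t.degree = 0 := by
        rw [map_add, Finsupp.degree_single] at hs
        omega
      rw [Finsupp.degree_eq_zero_iff] at ht
      exact ⟨a, by rw [ht, add_zero]⟩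
    have := coeff_pderiv (i := a) (trl y p) 0
    rw [← trl_pderiv, constCoeff_trl] at this
    simp [Finsupp.single_left_inj]
    simpa using this
  · apply Finset.sum_eq_zero
    intro l _
    rw [if_neg (by rintro rfl; simp at hs), mul_zero]
/-- Lemma 2.6: if the singular points of `Y = {f = 0}` are ordinary double points and for
each singular point `y` there is a homogeneous polynomial of degree `e = k - i(d-1)`
nonvanishing at `y` and vanishing at the other singular points, then the order-`i` jet map
on `I^{(i)}_k` is surjective. -/
theorem stmt1 (n d : ℕ) (hn : 2 ≤ n) (hd : 2 ≤ d)
    (f : MvPolynomial (Fin (n + 1)) ℂ) (hf : f.IsHomogeneous d)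
    (hODP : ∀ y : Fin (n + 1) → ℂ, y ≠ 0 → (∀ j, eval y (pderiv j f) = 0) →
      (hess f y).rank = n)
    (S : Finset (Fin (n + 1) → ℂ))
    (hS0 : ∀ y ∈ S, y ≠ 0)
    (hSsing : ∀ y ∈ S, ∀ j, eval y (pderiv j f) = 0)
    (hSprop : ∀ y ∈ S, ∀ y' ∈ S, y ≠ y' → ∀ c : ℂ, y ≠ c • y')
    (hSrep : ∀ y : Fin (n + 1) → ℂ, y ≠ 0 → (∀ j, eval y (pderiv j f) = 0) →
      ∃ y' ∈ S, ∃ c : ℂ, y = c • y')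
    (i k e : ℕ) (hik : i ≤ k) (hke : k = i * (d - 1) + e)
    (hsep : ∀ y ∈ S, ∃ gy : MvPolynomial (Fin (n + 1)) ℂ, gy.IsHomogeneous e ∧
      eval y gy ≠ 0 ∧ ∀ y' ∈ S, y' ≠ y → eval y' gy = 0)
    (h : (Fin (n + 1) → ℂ) → MvPolynomial (Fin (n + 1)) ℂ)
    (hh : ∀ y ∈ S, (h y).IsHomogeneous k ∧ vOrd i y (h y)) :
    ∃ g : MvPolynomial (Fin (n + 1)) ℂ, g.IsHomogeneous k ∧
      (∀ y ∈ S, vOrd i y g) ∧ ∀ y ∈ S, vOrd (i + 1) y (g - h y) := by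
  classical
  have main : ∀ y ∈ S, ∃ q : MvPolynomial (Fin (n + 1)) ℂ, q.IsHomogeneous k ∧
      (∀ y' ∈ S, y' ≠ y → vOrd (i + 1) y' q) ∧ vOrd (i + 1) y (q - h y) := by
    intro y hy
    obtain ⟨gy, hgh, hgy, hg0⟩ := hsep y hy
    obtain ⟨hhk, hhv⟩ := hh y hy
    rw [vOrd_iff] at hhv
    set H := homogeneousComponent i (trl y (h y)) with hH
    have hAy : (hess f y).transpose.mulVec y = 0 := by
      ext j
      have := congrArg (eval y) (hf.pderiv (i := j)).sum_X_mul_pderiv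
      simp only [map_sum, map_mul, eval_X, map_nsmul, hSsing y hy j, smul_zero] at this
      simp only [Matrix.mulVec, dotProduct, hess, Matrix.transpose_apply, Matrix.of_apply,
        Pi.zero_apply]
      rw [← this]
      exact Finset.sum_congr rfl fun l _ => mul_comm _ _
    obtain ⟨P, hP, hPH⟩ := exists_P (hess f y).transpose y (hS0 y hy)
      (by rw [Matrix.rank_transpose]; exact hODP y (hS0 y hy) (hSsing y hy)) hAy i H
      (homogeneousComponent_isHomogeneous _ _) (euler_lead y i k (h y) hhk hhv)
    set L : (Fin (n + 1) → ℂ) → Fin (n + 1) → MvPolynomial (Fin (n + 1)) ℂ :=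
      fun z j => ∑ l, C ((hess f z).transpose j l) * X l with hL
    have hLd : ∀ z ∈ S, ∀ j, trl z (pderiv j f) - L z j ∈ idealOfVars (Fin (n + 1)) ℂ ^ 2 :=
      fun z hz j => lin_part z (pderiv j f) (hSsing z hz j)
    have hLh : ∀ z j, (L z j).IsHomogeneous 1 := fun z j =>
      IsHomogeneous.sum _ _ _ fun l _ => isHomogeneous_C_mul_X _ _
    have hL1 : ∀ z j, L z j ∈ idealOfVars (Fin (n + 1)) ℂ := fun z j => by
      simpa using homog_mem 1 _ (hLh z j)
    have hQ : ∀ z ∈ S, trl z (aeval (fun j => pderiv j f) P) - aeval (L z) P ∈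
        idealOfVars (Fin (n + 1)) ℂ ^ (i + 1) := by
      intro z hz
      have := aeval_sub_mem (fun j => trl z (pderiv j f)) (L z) (hL1 z) (hLd z hz) i P hP
      rwa [← comp_aeval_apply] at this
    have hQi : ∀ z ∈ S, trl z (aeval (fun j => pderiv j f) P) ∈
        idealOfVars (Fin (n + 1)) ℂ ^ i := by
      intro z hz
      have h1 : aeval (L z) P ∈ idealOfVars (Fin (n + 1)) ℂ ^ i := by
        apply homog_mem
        simpa using hP.aeval (L z) (hLh z)
      have := Ideal.add_mem _ (Ideal.pow_le_pow_right (Nat.le_succ i) (hQ z hz)) h1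
      simpa using this
    have hg1 : ∀ z (g : MvPolynomial (Fin (n + 1)) ℂ), eval z g = 0 →
        trl z g ∈ idealOfVars (Fin (n + 1)) ℂ := by
      intro z g hg
      rw [← pow_one (idealOfVars (Fin (n + 1)) ℂ), mem_pow_idealOfVars_iff']
      intro s hs
      have : s = 0 := by rw [← Finsupp.degree_eq_zero_iff]; omega
      rw [this, constCoeff_trl, hg]
    refine ⟨C (eval y gy)⁻¹ * gy * aeval (fun j => pderiv j f) P, ?_, ?_, ?_⟩
    · have h1 := hP.aeval (fun j => pderiv j f) (fun j => hf.pderiv (i := j))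
      have h2 := (hgh.C_mul (eval y gy)⁻¹).mul h1
      rw [hke]
      convert h2 using 1
      ring
    · intro z hz hzy
      rw [vOrd_iff, map_mul, pow_succ']
      refine Ideal.mul_mem_mul (hg1 z _ ?_) (hQi z hz)
      rw [map_mul, hg0 z hz hzy, mul_zero]
    · rw [vOrd_iff]
      set Q := aeval (fun j => pderiv j f) P with hQdef
      set w := C (eval y gy)⁻¹ * gy with hw
      have h1 : trl y (w - 1) ∈ idealOfVars (Fin (n + 1)) ℂ := hg1 y _ (by simp [hw, hgy])
      have e : trl y (w * Q - h y) = trl y (w - 1) * trl y Q + (trl y Q - aeval (L y) P)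
          - (trl y (h y) - H) := by
        rw [show aeval (L y) P = H from hPH]
        simp only [map_sub, map_mul, map_one]
        ring
      rw [e]
      refine Ideal.sub_mem _ (Ideal.add_mem _ ?_ (hQ y hy)) (sub_comp_mem _ _ hhv)
      rw [pow_succ']
      exact Ideal.mul_mem_mul h1 (hQi y hy)
  choose! q hq1 hq2 hq3 using main
  have hlast : ∀ y ∈ S, vOrd (i + 1) y (∑ z ∈ S, q z - h y) := by
    intro y hy
    have e : ∑ z ∈ S, q z - h y = ∑ z ∈ S.erase y, q z + (q y - h y) := by
      rw [← Finset.sum_erase_add _ _ hy]; ring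
    rw [e, vOrd_iff, map_add, map_sum]
    refine Ideal.add_mem _ (Ideal.sum_mem _ fun z hz => ?_) ((vOrd_iff _ _ _).1 (hq3 y hy))
    exact (vOrd_iff _ _ _).1
      (hq2 z (Finset.mem_of_mem_erase hz) y hy (Finset.ne_of_mem_erase hz).symm)
  refine ⟨∑ z ∈ S, q z, IsHomogeneous.sum _ _ _ hq1, fun y hy => ?_, hlast⟩
  have h1 := (vOrd_iff _ _ _).1 (hlast y hy)
  have h2 := (vOrd_iff _ _ _).1 (hh y hy).2
  rw [vOrd_iff]
  have := Ideal.add_mem _ (Ideal.pow_le_pow_right (Nat.le_succ i) h1) h2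
  rw [← map_add] at this
  simpa using this
end

section
/- Let n ≥ 2 and h = z_1² + ⋯ + z_n² ∈ ℂ[z_1,…,z_n]. Let q and j be integers with j ≠ 2q, q ≠ 0, and j + 2 > n. Then for every homogeneous polynomial F ∈ ℂ[z_1,…,z_n] of degree j + 2 − n there exist homogeneous polynomials g_1, …, g_n of degree j − n + 1 such that h·(Σ_{i=1}^n ∂g_i/∂z_i) − 2q·(Σ_{i=1}^n z_i g_i) = F. -/
open MvPolynomial

/-- Lemma 4.2(i), in coordinates: for `h = z_1² + ⋯ + z_n²`, `j ≠ 2q`, `q ≠ 0` and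
`j + 2 > n`, every homogeneous polynomial `F` of degree `j + 2 - n` can be written as
`h·(Σ ∂g_i/∂z_i) − 2q·(Σ z_i g_i)` with the `g_i` homogeneous of degree `j - n + 1`. -/
theorem stmt3 (n : ℕ) (hn : 2 ≤ n) (q j : ℤ) (hj : j ≠ 2 * q) (hq : q ≠ 0)
    (hjn : (n : ℤ) < j + 2)
    (F : MvPolynomial (Fin n) ℂ) (hF : F.IsHomogeneous (j + 2 - n).toNat) :
    ∃ g : Fin n → MvPolynomial (Fin n) ℂ,
      (∀ i, (g i).IsHomogeneous (j - n + 1).toNat) ∧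
      (∑ i, X i ^ 2 : MvPolynomial (Fin n) ℂ) * (∑ i, pderiv i (g i)) -
        C (2 * (q : ℂ)) * (∑ i, X i * g i) = F := by
  obtain ⟨d, hd⟩ : ∃ d : ℕ, j = d + n - 1 := ⟨(j - n + 1).toNat, by omega⟩
  have e1 : (j + 2 - n).toNat = d + 1 := by omega
  have e2 : (j - n + 1).toNat = d := by omega
  rw [e1] at hF
  rw [e2]
  have hjC : (j : ℂ) = d + n - 1 := by rw [hd]; push_cast; ring
  have hqC : (q : ℂ) ≠ 0 := by exact_mod_cast hq
  have hjq : (j : ℂ) - 2 * q ≠ 0 := by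
    rw [sub_ne_zero]; exact_mod_cast hj
  have hd1 : (d : ℂ) + 1 ≠ 0 := by exact_mod_cast Nat.succ_ne_zero d
  have hP : ∀ i, (pderiv i F).IsHomogeneous d := fun i => by
    simpa using hF.pderiv (i := i)
  have hEF : ∑ i, X i * pderiv i F = C ((d : ℂ) + 1) * F := by
    rw [hF.sum_X_mul_pderiv]; simp [nsmul_eq_mul]
  obtain ⟨L, hL⟩ : ∃ L, L = ∑ i, pderiv i (pderiv i F) := ⟨_, rfl⟩
  have hXL : ∀ i, (X i * L).IsHomogeneous d := by
    intro i
    rcases d with _ | d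
    · have : L = 0 := by
        rw [hL]
        refine Finset.sum_eq_zero fun i _ => ?_
        have := hP i
        rw [← totalDegree_zero_iff_isHomogeneous, totalDegree_eq_zero_iff_eq_C] at this
        rw [this, pderiv_C]
      rw [this, mul_zero]; exact isHomogeneous_zero _ _ _
    · rw [add_comm]
      refine (isHomogeneous_X _ _).mul ?_
      rw [hL]
      exact IsHomogeneous.sum _ _ _ fun i _ => by simpa using (hP i).pderiv (i := i)
  -- divergence of `X i * L`
  have hdiv : ∑ i, pderiv i (X i * L) = C ((d : ℂ) + n - 1) * L := by
    have h1 : ∑ i, pderiv i (X i * L) = (n : MvPolynomial (Fin n) ℂ) * L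
        + ∑ i, X i * pderiv i L := by
      simp [Derivation.leibniz, Finset.sum_add_distrib, add_comm]
    rw [h1]
    rcases d with _ | d
    · have : L = 0 := by
        rw [hL]
        refine Finset.sum_eq_zero fun i _ => ?_
        have := hP i
        rw [← totalDegree_zero_iff_isHomogeneous, totalDegree_eq_zero_iff_eq_C] at this
        rw [this, pderiv_C]
      simp [this]
    · have hLh : L.IsHomogeneous d := by
        rw [hL]
        exact IsHomogeneous.sum _ _ _ fun i _ => by simpa using (hP i).pderiv (i := i)
      rw [hLh.sum_X_mul_pderiv]
      simp [nsmul_eq_mul]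
      ring
  obtain ⟨a, ha⟩ : ∃ a : ℂ, a * (2 * q * (d + 1)) = -1 :=
    ⟨-(2 * (q : ℂ) * ((d : ℂ) + 1))⁻¹, by field_simp⟩
  obtain ⟨b, hb⟩ : ∃ b : ℂ, b * ((d + n - 1) - 2 * q) = -a :=
    ⟨-a * ((j : ℂ) - 2 * q)⁻¹, by rw [← hjC]; field_simp⟩
  refine ⟨fun i => C a * pderiv i F + C b * (X i * L), fun i => ?_, ?_⟩
  · exact ((hP i).C_mul a).add ((hXL i).C_mul b)
  · have s1 : ∑ i, pderiv i (C a * pderiv i F + C b * (X i * L))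
        = C a * L + C b * (C ((d : ℂ) + n - 1) * L) := by
      rw [← hdiv, hL, Finset.mul_sum, Finset.mul_sum, ← Finset.sum_add_distrib]
      refine Finset.sum_congr rfl fun i _ => ?_
      rw [map_add, pderiv_C_mul, pderiv_C_mul]
    have s2 : ∑ i, X i * (C a * pderiv i F + C b * (X i * L))
        = C a * (C ((d : ℂ) + 1) * F) + C b * ((∑ i, X i ^ 2) * L) := by
      rw [← hEF, Finset.sum_mul, Finset.mul_sum, Finset.mul_sum, ← Finset.sum_add_distrib]
      exact Finset.sum_congr rfl fun i _ => by ring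
    have ha' := congrArg (C (σ := Fin n)) ha
    have hb' := congrArg (C (σ := Fin n)) hb
    rw [s1, s2]
    simp only [map_mul, map_sub, map_add, map_neg, map_one] at ha' hb' ⊢
    linear_combination (∑ i, X i ^ 2) * L * hb' - F * ha'
end

section
/- Let n ≥ 2 and h = z_1² + ⋯ + z_n² ∈ ℂ[z_1,…,z_n]. Let q and j be integers with j ≠ 2q and q ∉ {0,1}. Suppose g_1, …, g_n are homogeneous polynomials of degree j − n + 1 satisfying h·(Σ_{i=1}^n ∂g_i/∂z_i) − 2q·(Σ_{i=1}^n z_i g_i) = 0. Then there exists a family (s_{l i})_{1 ≤ l, i ≤ n} of homogeneous polynomials of degree j − n with s_{l i} = −s_{i l} for all i, l, such that g_i = h·(Σ_{l=1}^n ∂s_{l i}/∂z_l) − 2(q−1)·(Σ_{l=1}^n z_l s_{l i}) for every i. -/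
open MvPolynomial

/-- `g` is homogeneous of (possibly negative) integer degree `a`; the zero polynomial
is homogeneous of every degree. -/
def IsHomogeneousI {σ : Type*} (g : MvPolynomial σ ℂ) (a : ℤ) : Prop :=
  g = 0 ∨ ∃ k : ℕ, (k : ℤ) = a ∧ g.IsHomogeneous k

namespace Stmt4Aux

variable {n : ℕ}

lemma hadd {f g : MvPolynomial (Fin n) ℂ} {a : ℤ} (hf : IsHomogeneousI f a)
    (hg : IsHomogeneousI g a) : IsHomogeneousI (f + g) a := by
  rcases hf with rfl | ⟨k, hk, hf⟩
  · simpa using hg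
  · rcases hg with rfl | ⟨m, hm, hg⟩
    · right; exact ⟨k, hk, by simpa using hf⟩
    · right
      obtain rfl : m = k := by omega
      exact ⟨m, hk, hf.add hg⟩

lemma hCmul {f : MvPolynomial (Fin n) ℂ} {a : ℤ} (c : ℂ) (hf : IsHomogeneousI f a) :
    IsHomogeneousI (C c * f) a := by
  rcases hf with rfl | ⟨k, hk, hf⟩
  · left; simp
  · right; exact ⟨k, hk, hf.C_mul c⟩

lemma hsub {f g : MvPolynomial (Fin n) ℂ} {a : ℤ} (hf : IsHomogeneousI f a)
    (hg : IsHomogeneousI g a) : IsHomogeneousI (f - g) a := by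
  have := hadd hf (hCmul (-1) hg)
  simpa [sub_eq_add_neg] using this

lemma hXmul {f : MvPolynomial (Fin n) ℂ} {a b : ℤ} (i : Fin n) (hf : IsHomogeneousI f a)
    (hb : b = a + 1) : IsHomogeneousI (X i * f) b := by
  rcases hf with rfl | ⟨k, hk, hf⟩
  · left; simp
  · right; exact ⟨1 + k, by push_cast; omega, (isHomogeneous_X ℂ i).mul hf⟩

lemma hpderiv {f : MvPolynomial (Fin n) ℂ} {a b : ℤ} (i : Fin n) (hf : IsHomogeneousI f a)
    (hb : b = a - 1) : IsHomogeneousI (pderiv i f) b := by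
  rcases hf with rfl | ⟨k, hk, hf⟩
  · left; simp
  · rcases k with _ | k
    · left
      rw [← totalDegree_zero_iff_isHomogeneous, totalDegree_eq_zero_iff_eq_C] at hf
      rw [hf, pderiv_C]
    · right; exact ⟨k, by push_cast at hk; omega, hf.pderiv⟩

lemma hsum {ι : Type*} (s : Finset ι) {f : ι → MvPolynomial (Fin n) ℂ} {a : ℤ}
    (hf : ∀ i, IsHomogeneousI (f i) a) : IsHomogeneousI (∑ i ∈ s, f i) a := by
  classical
  induction s using Finset.induction_on with
  | empty => left; simp
  | insert i s hi ih => rw [Finset.sum_insert hi]; exact hadd (hf i) ih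

lemma heuler {f : MvPolynomial (Fin n) ℂ} {a : ℤ} (hf : IsHomogeneousI f a) :
    ∑ i, X i * pderiv i f = C (a : ℂ) * f := by
  rcases hf with rfl | ⟨k, hk, hf⟩
  · simp
  · rw [hf.sum_X_mul_pderiv, ← hk]; simp

lemma pcomm (f : MvPolynomial (Fin n) ℂ) (i l : Fin n) :
    pderiv i (pderiv l f) = pderiv l (pderiv i f) := by
  ext m
  rcases eq_or_ne i l with rfl | h
  · rfl
  · simp only [coeff_pderiv, add_right_comm m]
    simp [Finsupp.single_apply, h, h.symm]
    ring

lemma sum_pderiv_X (p : MvPolynomial (Fin n) ℂ) (i : Fin n) (f : Fin n → MvPolynomial (Fin n) ℂ) :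
    ∑ l, pderiv l (X i) * f l = f i := by
  classical
  simp [pderiv_X, Pi.single_apply]

lemma div_X_mul {f : MvPolynomial (Fin n) ℂ} {a : ℤ} (hf : IsHomogeneousI f a) :
    ∑ l, pderiv l (X l * f) = C ((n : ℂ) + a) * f := by
  simp [pderiv_mul, Finset.sum_add_distrib, heuler hf, add_mul]
  ring

lemma div_X_mul' (i : Fin n) (b : Fin n → MvPolynomial (Fin n) ℂ) :
    ∑ l, pderiv l (X i * b l) = b i + X i * ∑ l, pderiv l (b l) := by
  simp only [pderiv_mul, Finset.sum_add_distrib, Finset.mul_sum, sum_pderiv_X 0]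

lemma koszul {f : Fin n → MvPolynomial (Fin n) ℂ} {d : ℤ} (hd : d + 1 ≠ 0)
    (hf : ∀ i, IsHomogeneousI (f i) d) (h0 : ∑ i, X i * f i = 0) :
    ∃ a : Fin n → Fin n → MvPolynomial (Fin n) ℂ, (∀ l i, IsHomogeneousI (a l i) (d - 1)) ∧
      (∀ l i, a l i = - a i l) ∧ ∀ i, f i = ∑ l, X l * a l i := by
  refine ⟨fun l i => C (1 / ((d : ℂ) + 1)) * (pderiv l (f i) - pderiv i (f l)), ?_, ?_, ?_⟩
  · intro l i
    exact hCmul _ (hsub (hpderiv _ (hf _) rfl) (hpderiv _ (hf _) rfl))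
  · intro l i; ring
  · intro i
    have h1 := congrArg (pderiv i) h0
    simp only [map_sum, pderiv_mul, Finset.sum_add_distrib, map_zero] at h1
    have h2 : ∑ l, pderiv i (X l) * f l = f i := by
      classical
      simp [pderiv_X, Pi.single_apply]
    rw [h2] at h1
    have h3 := heuler (hf i)
    have hc : (d : ℂ) + 1 ≠ 0 := by exact_mod_cast hd
    have h4 : (C (1 / ((d : ℂ) + 1)) : MvPolynomial (Fin n) ℂ) * (C (d : ℂ) + 1) = 1 := by
      rw [← C_1, ← C_add, ← C_mul]; congr 1; field_simp
    have h5 : ∑ l, X l * (C (1 / ((d : ℂ) + 1)) * (pderiv l (f i) - pderiv i (f l))) =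
        C (1 / ((d : ℂ) + 1)) * (∑ l, X l * pderiv l (f i) - ∑ l, X l * pderiv i (f l)) := by
      rw [← Finset.sum_sub_distrib, Finset.mul_sum]
      refine Finset.sum_congr rfl fun l _ => by ring
    rw [h5, h3]
    linear_combination (-f i) * h4 + C (1 / ((d : ℂ) + 1)) * h1

lemma divdiv {a : Fin n → Fin n → MvPolynomial (Fin n) ℂ} (ha : ∀ l i, a l i = - a i l) :
    ∑ i, pderiv i (∑ l, pderiv l (a l i)) = 0 := by
  have h : ∑ i, pderiv i (∑ l, pderiv l (a l i)) = - ∑ i, pderiv i (∑ l, pderiv l (a l i)) := by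
    conv_lhs => simp only [map_sum]
    rw [Finset.sum_comm]
    simp only [map_sum, ← Finset.sum_neg_distrib]
    refine Finset.sum_congr rfl fun l _ => Finset.sum_congr rfl fun i _ => ?_
    rw [pcomm, ha l i]
    simp
  exact self_eq_neg.mp h

end Stmt4Aux

open Stmt4Aux in
/-- Lemma 4.2(ii), in coordinates: for `h = z_1² + ⋯ + z_n²`, `j ≠ 2q` and `q ∉ {0,1}`,
any homogeneous solution `(g_i)` of `h·(Σ ∂g_i/∂z_i) − 2q·(Σ z_i g_i) = 0` of degree
`j - n + 1` comes from an antisymmetric family `(s_{l i})` of degree `j - n` via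
`g_i = h·(Σ_l ∂s_{l i}/∂z_l) − 2(q−1)·(Σ_l z_l s_{l i})`. -/
theorem stmt4 (n : ℕ) (hn : 2 ≤ n) (q j : ℤ) (hj : j ≠ 2 * q) (hq0 : q ≠ 0) (hq1 : q ≠ 1)
    (g : Fin n → MvPolynomial (Fin n) ℂ)
    (hg : ∀ i, IsHomogeneousI (g i) (j - n + 1))
    (heq : (∑ i, X i ^ 2 : MvPolynomial (Fin n) ℂ) * (∑ i, pderiv i (g i)) -
      C (2 * (q : ℂ)) * (∑ i, X i * g i) = 0) :
    ∃ s : Fin n → Fin n → MvPolynomial (Fin n) ℂ,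
      (∀ l i, IsHomogeneousI (s l i) (j - n)) ∧
      (∀ l i, s l i = - s i l) ∧
      ∀ i, g i = (∑ l, X l ^ 2 : MvPolynomial (Fin n) ℂ) * (∑ l, pderiv l (s l i)) -
        C (2 * ((q : ℂ) - 1)) * (∑ l, X l * s l i) := by
  by_cases hd : j - n + 1 < 0
  · have hz : ∀ i, g i = 0 := fun i => by
      rcases hg i with h | ⟨k, hk, -⟩
      · exact h
      · omega
    refine ⟨fun _ _ => 0, fun _ _ => Or.inl rfl, by simp, fun i => by simp [hz]⟩
  have hqc : (q : ℂ) ≠ 0 := by exact_mod_cast hq0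
  have hq1c : (q : ℂ) - 1 ≠ 0 := by rw [sub_ne_zero]; exact_mod_cast hq1
  have hjc : (j : ℂ) - 2 * q ≠ 0 := by rw [sub_ne_zero]; exact_mod_cast hj
  obtain ⟨u, hu⟩ : ∃ u, u = C (1 / (2 * (q : ℂ))) * ∑ i, pderiv i (g i) := ⟨_, rfl⟩
  have hqq : (C (2 * (q : ℂ)) * C (1 / (2 * (q : ℂ))) : MvPolynomial (Fin n) ℂ) = 1 := by
    rw [← C_mul, ← C_1]; congr 1; field_simp
  have hdiv : ∑ i, pderiv i (g i) = C (2 * (q : ℂ)) * u := by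
    rw [hu]; linear_combination (-∑ i, pderiv i (g i)) * hqq
  have huh : IsHomogeneousI u (j - n) := by
    rw [hu]; exact hCmul _ (hsum _ fun i => hpderiv _ (hg i) (by ring))
  have hzg : ∑ i, X i * (g i - X i * u) = 0 := by
    have : ∑ i, X i * (g i - X i * u) = ∑ i, X i * g i - (∑ i, X i ^ 2) * u := by
      rw [Finset.sum_mul, ← Finset.sum_sub_distrib]
      exact Finset.sum_congr rfl fun i _ => by ring
    rw [this, hu]
    linear_combination (-C (1 / (2 * (q : ℂ)))) * heq - (∑ i, X i * g i) * hqq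
  obtain ⟨a, hah, haa, haf⟩ := koszul (d := j - n + 1) (by omega)
    (fun i => hsub (hg i) (hXmul i huh rfl)) hzg
  obtain ⟨b, hb⟩ : ∃ b : Fin n → MvPolynomial (Fin n) ℂ, b = fun i => ∑ l, pderiv l (a l i) :=
    ⟨_, rfl⟩
  have hbi : ∀ i, ∑ l, pderiv l (a l i) = b i := fun i => by rw [hb]
  have hbh : ∀ i, IsHomogeneousI (b i) (j - n - 1) := fun i => by
    rw [← hbi]; exact hsum _ fun l => hpderiv _ (hah l i) (by ring)
  have hbd : ∑ i, pderiv i (b i) = 0 := by rw [hb]; exact divdiv haa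
  -- the relation between `u` and `b`
  have hub : C ((j : ℂ) - 2 * q) * u = ∑ l, X l * b l := by
    have h1 : ∀ i, g i = X i * u + ∑ l, X l * a l i := fun i => by
      linear_combination haf i
    have h2 : ∑ i, pderiv i (∑ l, X l * a l i) = - ∑ l, X l * b l := by
      simp only [map_sum]
      rw [Finset.sum_comm, ← Finset.sum_neg_distrib]
      refine Finset.sum_congr rfl fun l _ => ?_
      rw [div_X_mul', ← hbi]
      have h0 : a l l = 0 := self_eq_neg.mp (haa l l)
      rw [h0, zero_add, ← mul_neg, ← Finset.sum_neg_distrib]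
      congr 1
      refine Finset.sum_congr rfl fun i _ => ?_
      rw [haa l i, map_neg]
    have h3 : ∑ i, pderiv i (g i) = C ((n : ℂ) + (j - n : ℤ)) * u - ∑ l, X l * b l := by
      rw [← div_X_mul huh, sub_eq_add_neg, ← h2, ← Finset.sum_add_distrib]
      refine Finset.sum_congr rfl fun i _ => ?_
      rw [← map_add, ← h1]
    rw [hdiv] at h3
    have h4 : (n : ℂ) + (j - n : ℤ) = j := by push_cast; ring
    rw [h4] at h3
    rw [C_sub]
    linear_combination -h3
  obtain ⟨α, hα⟩ : ∃ α : ℂ, α = -1 / (2 * ((q : ℂ) - 1)) := ⟨_, rfl⟩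
  obtain ⟨β, hβ⟩ : ∃ β : ℂ, β = 1 / (2 * ((q : ℂ) - 1) * (j - 2 * q)) := ⟨_, rfl⟩
  refine ⟨fun l i => C α * a l i + C β * (X l * b i - X i * b l), ?_, ?_, ?_⟩
  · intro l i
    exact hadd (hCmul _ (by simpa using hah l i))
      (hCmul _ (hsub (hXmul _ (hbh _) (by ring)) (hXmul _ (hbh _) (by ring))))
  · intro l i
    linear_combination C α * haa l i
  · intro i
    have e1 : ∑ l, pderiv l (C α * a l i + C β * (X l * b i - X i * b l)) =
        C α * b i + C β * (C ((n : ℂ) + (j - n - 1 : ℤ)) * b i - b i) := by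
      simp only [map_add, map_sub, pderiv_C_mul, Finset.sum_add_distrib, ← Finset.mul_sum,
        Finset.sum_sub_distrib, hbi]
      rw [← map_add C, div_X_mul' i b, hbd, mul_zero, add_zero, div_X_mul (hbh i)]
    have e2 : ∑ l, X l * (C α * a l i + C β * (X l * b i - X i * b l)) =
        C α * (∑ l, X l * a l i) + C β * ((∑ l, X l ^ 2) * b i - X i * ∑ l, X l * b l) := by
      simp only [Finset.mul_sum, Finset.sum_mul, ← Finset.sum_sub_distrib,
        ← Finset.sum_add_distrib]
      exact Finset.sum_congr rfl fun l _ => by ring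
    rw [e1, e2, ← hub, ← haf i]
    have c0 : (n : ℂ) + (j - n - 1 : ℤ) = j - 1 := by push_cast; ring
    have c1 : (C (2 * ((q : ℂ) - 1)) * C α : MvPolynomial (Fin n) ℂ) = -1 := by
      rw [← C_mul, ← C_1, ← C_neg, hα]; congr 1; field_simp
    have c2 : (C (2 * ((q : ℂ) - 1)) * C β * C ((j : ℂ) - 2 * q) : MvPolynomial (Fin n) ℂ) = 1 := by
      rw [← C_mul, ← C_mul, ← C_1, hβ]; congr 1; field_simp
    have c3 : (C α + C β * (C ((j : ℂ) - 1) - 1) - C (2 * ((q : ℂ) - 1)) * C β :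
        MvPolynomial (Fin n) ℂ) = 0 := by
      rw [← C_1, ← C_sub, ← C_mul, ← C_mul, ← C_add, ← C_sub, ← C_0, hα, hβ]; congr 1
      field_simp; ring
    rw [c0]
    linear_combination (-(∑ l, X l ^ 2) * b i) * c3 + (g i - X i * u) * c1 - X i * u * c2
end

section
/- Let n ≥ 2, h = x_1² + ⋯ + x_n² ∈ ℂ[x_1,…,x_n], and m = ⌊n/2⌋. Let A = ℂ[x_1,…,x_n][h^{−1}] be the localization of the polynomial ring away from h, and let D_1, …, D_n be the unique ℂ-derivations of A extending the partial derivatives ∂/∂x_1, …, ∂/∂x_n. For p ≥ 0 let F_p ⊆ A be the ℂ[x_1,…,x_n]-submodule generated by all elements D^α(h^{−m}) = D_1^{α_1}⋯D_n^{α_n}(h^{−m}) with |α| ≤ p. Then F_p = { g·h^{−m−p} : g ∈ 𝔪^p }, where 𝔪 = (x_1,…,x_n) is the ideal generated by the variables. -/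
open MvPolynomial

/-- `h = x_1² + ⋯ + x_n²` (as a polynomial in `n` variables). -/
noncomputable def hpoly (n : ℕ) : MvPolynomial (Fin n) ℂ := ∑ i, X i ^ 2

/-- The localization `A = ℂ[x_1,…,x_n][h⁻¹]`. -/
noncomputable abbrev Aloc (n : ℕ) := Localization.Away (hpoly n)

/-- `h⁻¹` in the localization. -/
noncomputable def hinv (n : ℕ) : Aloc n := IsLocalization.Away.invSelf (hpoly n)

open scoped Pointwise in
theorem gen_pow_aux (n p : ℕ) (u : MvPolynomial (Fin n) ℂ)
    (hu : u ∈ (Set.range X : Set (MvPolynomial (Fin n) ℂ)) ^ p) : u.IsHomogeneous p := by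
  induction p generalizing u with
  | zero =>
    simp only [pow_zero, Set.mem_one] at hu
    subst hu
    exact isHomogeneous_one _ _
  | succ p ih =>
    rw [pow_succ] at hu
    obtain ⟨a, ha, b, ⟨i, rfl⟩, rfl⟩ := Set.mem_mul.1 hu
    exact (ih a ha).mul (isHomogeneous_X _ _)

open scoped Pointwise in
theorem pow_le_aux (n p : ℕ) (G : Ideal (MvPolynomial (Fin n) ℂ))
    (h : ∀ u ∈ Ideal.span (Set.range X : Set (MvPolynomial (Fin n) ℂ)) ^ p,
      u.IsHomogeneous p → u ∈ G) :
    Ideal.span (Set.range X : Set (MvPolynomial (Fin n) ℂ)) ^ p ≤ G := by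
  have e : Ideal.span (Set.range X : Set (MvPolynomial (Fin n) ℂ)) ^ p
      = Ideal.span ((Set.range X : Set (MvPolynomial (Fin n) ℂ)) ^ p) :=
    Submodule.span_pow _ p
  rw [e] at h
  rw [e, Ideal.span_le]
  intro u hu
  exact h u (Ideal.subset_span hu) (gen_pow_aux n p u hu)

theorem pderiv_mem_aux (n p : ℕ) (i : Fin n) (g : MvPolynomial (Fin n) ℂ)
    (hg : g ∈ Ideal.span (Set.range X : Set (MvPolynomial (Fin n) ℂ)) ^ p) :
    pderiv i g ∈ Ideal.span (Set.range X : Set (MvPolynomial (Fin n) ℂ)) ^ (p - 1) := by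
  induction p generalizing g with
  | zero => simp
  | succ p ih =>
    rw [pow_succ] at hg
    simp only [Nat.add_sub_cancel]
    refine Submodule.mul_induction_on hg ?_ ?_
    · intro a ha b hb
      rw [Derivation.leibniz, smul_eq_mul, smul_eq_mul]
      refine Ideal.add_mem _ (Ideal.mul_mem_right _ _ ha) ?_
      rcases p with _ | p
      · simp
      · have := Ideal.mul_mem_mul hb (ih a ha)
        rw [Nat.add_sub_cancel, ← pow_succ'] at this
        exact this
    · intro a b ha hb
      rw [map_add]
      exact Ideal.add_mem _ ha hb

theorem hpoly_mem_aux (n : ℕ) :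
    hpoly n ∈ Ideal.span (Set.range X : Set (MvPolynomial (Fin n) ℂ)) ^ 2 := by
  refine Ideal.sum_mem _ fun i _ => Ideal.pow_mem_pow (Ideal.subset_span (Set.mem_range_self i)) 2

theorem pderiv_hpoly_aux (n : ℕ) (i : Fin n) : pderiv i (hpoly n) = 2 * X i := by
  classical
  simp only [hpoly, map_sum, Derivation.leibniz_pow, pderiv_X, Pi.single_apply]
  rw [Finset.sum_eq_single i]
  · simp
  · intro b _ hb
    simp [hb]
  · simp

theorem unit_mem_aux (n : ℕ) (c : ℂ) (hc : c ≠ 0) (f : MvPolynomial (Fin n) ℂ)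
    (G : Ideal (MvPolynomial (Fin n) ℂ)) (h : C c * f ∈ G) : f ∈ G := by
  have := G.mul_mem_left (C c⁻¹) h
  rwa [← mul_assoc, ← C_mul, inv_mul_cancel₀ hc, C_1, one_mul] at this

theorem poly_aux (n : ℕ) (hn : 2 ≤ n) (p : ℕ) (G : Ideal (MvPolynomial (Fin n) ℂ))
    (hG : ∀ i, ∀ g ∈ Ideal.span (Set.range X : Set (MvPolynomial (Fin n) ℂ)) ^ p,
      hpoly n * pderiv i g - C (2 * ((n / 2 + p : ℕ) : ℂ)) * (X i * g) ∈ G) :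
    Ideal.span (Set.range X : Set (MvPolynomial (Fin n) ℂ)) ^ (p + 1) ≤ G := by
  have key : ∀ i, ∀ g ∈ Ideal.span (Set.range X : Set (MvPolynomial (Fin n) ℂ)) ^ p,
      hpoly n * pderiv i g ∈ G := by
    rcases p with _ | d
    · -- homogeneous generator in degree zero
      have h1 : ∀ i, hpoly n * pderiv i (1 : MvPolynomial (Fin n) ℂ) -
          C (2 * ((n / 2 + 0 : ℕ) : ℂ)) * (X i * 1) ∈ G := fun i => hG i 1 (by simp)
      have hX : ∀ i, X i ∈ G := by
        intro i
        have := h1 i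
        simp only [Derivation.map_one_eq_zero, mul_zero, zero_sub, mul_one] at this
        refine unit_mem_aux n _ ?_ _ G (by simpa only [neg_neg] using G.neg_mem this)
        have : n / 2 + 0 ≠ 0 := by omega
        exact mul_ne_zero two_ne_zero (Nat.cast_ne_zero.2 this)
      intro i g _
      refine G.mul_mem_right _ ?_
      exact G.sum_mem fun i _ => by
        rw [pow_two]
        exact G.mul_mem_left _ (hX i)
    · have hle : Ideal.span (Set.range X : Set (MvPolynomial (Fin n) ℂ)) ^ d ≤
          Submodule.comap (LinearMap.mulLeft (MvPolynomial (Fin n) ℂ) (hpoly n)) G := by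
        refine pow_le_aux n d _ ?_
        intro u hu hom
        change hpoly n * u ∈ G
        have hs : ∑ i, (hpoly n * pderiv i (X i * u) -
            C (2 * ((n / 2 + (d + 1) : ℕ) : ℂ)) * (X i * (X i * u))) ∈ G := by
          refine G.sum_mem fun i _ => hG i _ ?_
          rw [pow_succ']
          exact Ideal.mul_mem_mul (Ideal.subset_span ⟨i, rfl⟩) hu
        have he : ∑ i, (hpoly n * pderiv i (X i * u) -
            C (2 * ((n / 2 + (d + 1) : ℕ) : ℂ)) * (X i * (X i * u))) =
            C ((n : ℂ) + d - 2 * ((n / 2 + (d + 1) : ℕ) : ℂ)) * (hpoly n * u) := by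
          have e1 : ∀ i : Fin n, pderiv i (X i * u) = u + X i * pderiv i u := by
            intro i
            rw [Derivation.leibniz, pderiv_X_self, smul_eq_mul, smul_eq_mul, mul_one, add_comm]
          have e2 : ∑ i : Fin n, X i * (X i * u) = hpoly n * u := by
            rw [hpoly, Finset.sum_mul]
            exact Finset.sum_congr rfl fun i _ => by ring
          rw [Finset.sum_sub_distrib, ← Finset.mul_sum, ← Finset.mul_sum, e2]
          simp only [e1]
          rw [Finset.sum_add_distrib, hom.sum_X_mul_pderiv]
          simp only [Finset.sum_const, Finset.card_univ, Fintype.card_fin, nsmul_eq_mul,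
            C_sub, C_add, map_natCast]
          ring
        rw [he] at hs
        refine unit_mem_aux n _ ?_ _ G hs
        have : ((n : ℤ) + d - 2 * ((n / 2 + (d + 1) : ℕ) : ℤ)) ≠ 0 := by omega
        exact_mod_cast this
      intro i g hg
      exact hle (pderiv_mem_aux n (d + 1) i g hg)
  rw [pow_succ', Ideal.mul_le]
  intro a ha g hg
  refine Submodule.span_induction (p := fun a _ => a * g ∈ G) ?_ ?_ ?_ ?_ ha
  · rintro _ ⟨i, rfl⟩
    have := G.sub_mem (key i g hg) (hG i g hg)
    rw [sub_sub_cancel] at this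
    refine unit_mem_aux n _ ?_ _ G this
    have : n / 2 + p ≠ 0 := by omega
    exact mul_ne_zero two_ne_zero (Nat.cast_ne_zero.2 this)
  · simp
  · intro x y _ _ hx hy
    rw [add_mul]
    exact G.add_mem hx hy
  · intro r x _ hx
    rw [smul_eq_mul, mul_assoc]
    exact G.mul_mem_left _ hx

theorem hinv_mul_aux (n : ℕ) :
    algebraMap (MvPolynomial (Fin n) ℂ) (Aloc n) (hpoly n) * hinv n = 1 :=
  IsLocalization.Away.mul_invSelf (hpoly n)

theorem up_aux (n : ℕ) (g : MvPolynomial (Fin n) ℂ) (k : ℕ) :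
    algebraMap (MvPolynomial (Fin n) ℂ) (Aloc n) g * hinv n ^ k =
      algebraMap (MvPolynomial (Fin n) ℂ) (Aloc n) (hpoly n * g) * hinv n ^ (k + 1) := by
  rw [map_mul, pow_succ]
  linear_combination (-algebraMap (MvPolynomial (Fin n) ℂ) (Aloc n) g * hinv n ^ k) *
    hinv_mul_aux n

theorem surj_aux (n : ℕ) (a : Aloc n) : ∃ (g : MvPolynomial (Fin n) ℂ) (k : ℕ),
    a = algebraMap (MvPolynomial (Fin n) ℂ) (Aloc n) g * hinv n ^ k := by
  obtain ⟨k, g, h⟩ := IsLocalization.Away.surj (hpoly n) a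
  refine ⟨g, k, ?_⟩
  rw [← h, mul_assoc, ← mul_pow, hinv_mul_aux, one_pow, mul_one]

theorem deriv_hinv_aux (n : ℕ)
    (D : Fin n → Derivation ℂ (Aloc n) (Aloc n))
    (hD : ∀ (i : Fin n) (r : MvPolynomial (Fin n) ℂ),
      D i (algebraMap (MvPolynomial (Fin n) ℂ) (Aloc n) r) =
        algebraMap (MvPolynomial (Fin n) ℂ) (Aloc n) (pderiv i r)) (i : Fin n) (k : ℕ) :
    D i (hinv n ^ k) =
      - ((2 * k * algebraMap (MvPolynomial (Fin n) ℂ) (Aloc n) (X i)) * hinv n ^ (k + 1)) := by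
  induction k with
  | zero => simp
  | succ k ih =>
    have h1 : D i (hinv n) = -(hinv n) ^ 2 *
        (2 * algebraMap (MvPolynomial (Fin n) ℂ) (Aloc n) (X i)) := by
      rw [Derivation.leibniz_of_mul_eq_one (D i) ((mul_comm _ _).trans (hinv_mul_aux n)), hD,
        pderiv_hpoly_aux, smul_eq_mul, map_mul, map_ofNat]
    rw [pow_succ (hinv n) k, Derivation.leibniz, ih, h1, smul_eq_mul, smul_eq_mul]
    push_cast
    ring

theorem deriv_aux (n : ℕ)
    (D : Fin n → Derivation ℂ (Aloc n) (Aloc n))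
    (hD : ∀ (i : Fin n) (r : MvPolynomial (Fin n) ℂ),
      D i (algebraMap (MvPolynomial (Fin n) ℂ) (Aloc n) r) =
        algebraMap (MvPolynomial (Fin n) ℂ) (Aloc n) (pderiv i r)) (i : Fin n) (g : MvPolynomial (Fin n) ℂ) (k : ℕ) :
    D i (algebraMap (MvPolynomial (Fin n) ℂ) (Aloc n) g * hinv n ^ k) =
      algebraMap (MvPolynomial (Fin n) ℂ) (Aloc n)
        (hpoly n * pderiv i g - C (2 * (k : ℂ)) * (X i * g)) * hinv n ^ (k + 1) := by
  rw [Derivation.leibniz, hD, deriv_hinv_aux n D hD, smul_eq_mul, smul_eq_mul, map_sub,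
    sub_mul, ← up_aux]
  simp only [C_mul, map_mul, map_natCast, map_ofNat]
  ring

theorem pderiv_pderiv_comm_aux (n : ℕ) (i j : Fin n) (r : MvPolynomial (Fin n) ℂ) :
    pderiv i (pderiv j r) = pderiv j (pderiv i r) := by
  classical
  have : ⁅(pderiv i : Derivation ℂ (MvPolynomial (Fin n) ℂ) (MvPolynomial (Fin n) ℂ)),
      (pderiv j : Derivation ℂ (MvPolynomial (Fin n) ℂ) (MvPolynomial (Fin n) ℂ))⁆ = 0 := by
    refine MvPolynomial.derivation_ext fun k => ?_
    rw [Derivation.commutator_apply, pderiv_X, pderiv_X]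
    simp only [Pi.single_apply]
    split_ifs <;> simp
  have h := congrArg (fun d => d r) this
  simp only [Derivation.commutator_apply] at h
  exact sub_eq_zero.1 h

theorem comm_aux (n : ℕ)
    (D : Fin n → Derivation ℂ (Aloc n) (Aloc n))
    (hD : ∀ (i : Fin n) (r : MvPolynomial (Fin n) ℂ),
      D i (algebraMap (MvPolynomial (Fin n) ℂ) (Aloc n) r) =
        algebraMap (MvPolynomial (Fin n) ℂ) (Aloc n) (pderiv i r)) (i j : Fin n) (a : Aloc n) : D i (D j a) = D j (D i a) := by
  have hz : ∀ r : MvPolynomial (Fin n) ℂ,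
      ⁅D i, D j⁆ (algebraMap (MvPolynomial (Fin n) ℂ) (Aloc n) r) = 0 := by
    intro r
    rw [Derivation.commutator_apply, hD, hD, hD, hD, pderiv_pderiv_comm_aux, sub_self]
  have hh : ⁅D i, D j⁆ (hinv n) = 0 := by
    rw [Derivation.leibniz_of_mul_eq_one _ ((mul_comm _ _).trans (hinv_mul_aux n)), hz, smul_zero]
  obtain ⟨g, k, rfl⟩ := surj_aux n a
  rw [← sub_eq_zero, ← Derivation.commutator_apply, Derivation.leibniz, Derivation.leibniz_pow,
    hz, hh]
  simp

theorem foldr_congr_aux (n : ℕ) (D : Fin n → Derivation ℂ (Aloc n) (Aloc n)) (x : Aloc n)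
    (α β : Fin n → ℕ) (l : List (Fin n)) (h : ∀ i ∈ l, α i = β i) :
    l.foldr (fun i x => (⇑(D i))^[α i] x) x = l.foldr (fun i x => (⇑(D i))^[β i] x) x := by
  induction l with
  | nil => rfl
  | cons j l ih =>
    rw [List.foldr_cons, List.foldr_cons, ih fun i hi => h i (List.mem_cons_of_mem _ hi),
      h j List.mem_cons_self]

theorem foldr_deriv_aux (n : ℕ)
    (D : Fin n → Derivation ℂ (Aloc n) (Aloc n))
    (hD : ∀ (i : Fin n) (r : MvPolynomial (Fin n) ℂ),
      D i (algebraMap (MvPolynomial (Fin n) ℂ) (Aloc n) r) =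
        algebraMap (MvPolynomial (Fin n) ℂ) (Aloc n) (pderiv i r)) (x : Aloc n)
    (α : Fin n → ℕ) (i : Fin n) (l : List (Fin n)) (hl : l.Nodup) (hi : i ∈ l) :
    D i (l.foldr (fun i x => (⇑(D i))^[α i] x) x) =
      l.foldr (fun j x => (⇑(D j))^[(α + Pi.single i 1 : Fin n → ℕ) j] x) x := by
  induction l with
  | nil => simp at hi
  | cons j l ih =>
    rw [List.nodup_cons] at hl
    rw [List.foldr_cons, List.foldr_cons]
    by_cases hij : i = j
    · subst hij
      rw [foldr_congr_aux n D x (α + Pi.single i 1) α l ?_, ← Function.iterate_succ_apply' (D i)]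
      · simp
      · intro k hk
        have : k ≠ i := fun h => hl.1 (h ▸ hk)
        simp [this]
    · have hil : i ∈ l := by simpa [hij] using hi
      rw [← ih hl.2 hil]
      have hc : Function.Commute (D i) (D j) := fun a => comm_aux n D hD i j a
      rw [(hc.iterate_right (α j)).eq]
      have : j ≠ i := fun h => hij h.symm
      simp [this]

/-- The submodule of all `g * h ^ (-(n/2) - p)` with `g` in the `p`-th power of the ideal. -/
noncomputable def MMaux (n p : ℕ) : Submodule (MvPolynomial (Fin n) ℂ) (Aloc n) :=
  Submodule.map (LinearMap.toSpanSingleton (MvPolynomial (Fin n) ℂ) (Aloc n)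
    (hinv n ^ (n / 2 + p))) (Ideal.span (Set.range X : Set (MvPolynomial (Fin n) ℂ)) ^ p)

theorem mem_MMaux (n p : ℕ) (a : Aloc n) : a ∈ MMaux n p ↔
    ∃ g ∈ Ideal.span (Set.range X : Set (MvPolynomial (Fin n) ℂ)) ^ p,
      a = algebraMap (MvPolynomial (Fin n) ℂ) (Aloc n) g * hinv n ^ (n / 2 + p) := by
  simp only [MMaux, Submodule.mem_map, LinearMap.toSpanSingleton_apply, Algebra.smul_def, eq_comm]

theorem MMaux_mono (n : ℕ) : Monotone (MMaux n) := by
  refine monotone_nat_of_le_succ fun p a ha => ?_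
  rw [mem_MMaux] at ha ⊢
  obtain ⟨g, hg, rfl⟩ := ha
  refine ⟨hpoly n * g, ?_, up_aux n g _⟩
  have := Ideal.mul_mem_mul (hpoly_mem_aux n) hg
  rw [← pow_add] at this
  exact Ideal.pow_le_pow_right (by omega) this

theorem deriv_MMaux (n : ℕ)
    (D : Fin n → Derivation ℂ (Aloc n) (Aloc n))
    (hD : ∀ (i : Fin n) (r : MvPolynomial (Fin n) ℂ),
      D i (algebraMap (MvPolynomial (Fin n) ℂ) (Aloc n) r) =
        algebraMap (MvPolynomial (Fin n) ℂ) (Aloc n) (pderiv i r)) (i : Fin n) (p : ℕ) (a : Aloc n)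
    (ha : a ∈ MMaux n p) : D i a ∈ MMaux n (p + 1) := by
  rw [mem_MMaux] at ha ⊢
  obtain ⟨g, hg, rfl⟩ := ha
  refine ⟨_, ?_, deriv_aux n D hD i g _⟩
  refine Ideal.sub_mem _ ?_ (Ideal.mul_mem_left _ _ ?_)
  · have := Ideal.mul_mem_mul (hpoly_mem_aux n) (pderiv_mem_aux n p i g hg)
    rw [← pow_add] at this
    exact Ideal.pow_le_pow_right (by omega) this
  · rw [pow_succ']
    exact Ideal.mul_mem_mul (Ideal.subset_span (Set.mem_range_self i)) hg

theorem iter_MMaux (n : ℕ)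
    (D : Fin n → Derivation ℂ (Aloc n) (Aloc n))
    (hD : ∀ (i : Fin n) (r : MvPolynomial (Fin n) ℂ),
      D i (algebraMap (MvPolynomial (Fin n) ℂ) (Aloc n) r) =
        algebraMap (MvPolynomial (Fin n) ℂ) (Aloc n) (pderiv i r)) (i : Fin n) (p k : ℕ) (a : Aloc n)
    (ha : a ∈ MMaux n p) : (⇑(D i))^[k] a ∈ MMaux n (k + p) := by
  induction k with
  | zero => simpa using ha
  | succ k ih =>
    rw [Function.iterate_succ_apply', show k + 1 + p = k + p + 1 by ring]
    exact deriv_MMaux n D hD i _ _ ih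

theorem foldr_MMaux (n : ℕ)
    (D : Fin n → Derivation ℂ (Aloc n) (Aloc n))
    (hD : ∀ (i : Fin n) (r : MvPolynomial (Fin n) ℂ),
      D i (algebraMap (MvPolynomial (Fin n) ℂ) (Aloc n) r) =
        algebraMap (MvPolynomial (Fin n) ℂ) (Aloc n) (pderiv i r)) (α : Fin n → ℕ) (l : List (Fin n)) :
    l.foldr (fun i x => (⇑(D i))^[α i] x) (hinv n ^ (n / 2)) ∈ MMaux n (l.map α).sum := by
  induction l with
  | nil =>
    rw [mem_MMaux]
    exact ⟨1, by simp, by simp⟩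
  | cons j l ih =>
    rw [List.foldr_cons, List.map_cons, List.sum_cons]
    exact iter_MMaux n D hD j _ _ _ ih

/-- The submodule generated by the derivatives of order at most `p`. -/
noncomputable def FFaux (n : ℕ) (D : Fin n → Derivation ℂ (Aloc n) (Aloc n)) (p : ℕ) :
    Submodule (MvPolynomial (Fin n) ℂ) (Aloc n) :=
  Submodule.span (MvPolynomial (Fin n) ℂ)
        { a : Aloc n | ∃ α : Fin n → ℕ, (∑ i, α i) ≤ p ∧
          a = (List.finRange n).foldr (fun i x => (⇑(D i))^[α i] x) (hinv n ^ (n / 2)) }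

theorem FFaux_le (n : ℕ)
    (D : Fin n → Derivation ℂ (Aloc n) (Aloc n))
    (hD : ∀ (i : Fin n) (r : MvPolynomial (Fin n) ℂ),
      D i (algebraMap (MvPolynomial (Fin n) ℂ) (Aloc n) r) =
        algebraMap (MvPolynomial (Fin n) ℂ) (Aloc n) (pderiv i r)) (p : ℕ) : FFaux n D p ≤ MMaux n p := by
  refine Submodule.span_le.2 ?_
  rintro _ ⟨α, hα, rfl⟩
  refine MMaux_mono n ?_ (foldr_MMaux n D hD α _)
  rwa [← List.sum_ofFn, List.ofFn_eq_map] at hα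

theorem FFaux_mono (n : ℕ) (D : Fin n → Derivation ℂ (Aloc n) (Aloc n)) (p : ℕ) :
    FFaux n D p ≤ FFaux n D (p + 1) := by
  refine Submodule.span_mono ?_
  rintro _ ⟨α, hα, rfl⟩
  exact ⟨α, by omega, rfl⟩

theorem deriv_FFaux (n : ℕ)
    (D : Fin n → Derivation ℂ (Aloc n) (Aloc n))
    (hD : ∀ (i : Fin n) (r : MvPolynomial (Fin n) ℂ),
      D i (algebraMap (MvPolynomial (Fin n) ℂ) (Aloc n) r) =
        algebraMap (MvPolynomial (Fin n) ℂ) (Aloc n) (pderiv i r)) (i : Fin n) (p : ℕ) (a : Aloc n)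
    (ha : a ∈ FFaux n D p) : D i a ∈ FFaux n D (p + 1) := by
  have ha' := ha
  unfold FFaux at ha'
  refine Submodule.span_induction (p := fun a _ => a ∈ FFaux n D p ∧ D i a ∈ FFaux n D (p + 1))
    ?_ ?_ ?_ ?_ ha' |>.2
  · rintro _ ⟨α, hα, rfl⟩
    refine ⟨Submodule.subset_span ⟨α, hα, rfl⟩, ?_⟩
    rw [foldr_deriv_aux n D hD _ α i _ (List.nodup_finRange n) (List.mem_finRange i)]
    refine Submodule.subset_span ⟨_, ?_, rfl⟩
    simp only [Pi.add_apply, Finset.sum_add_distrib, Finset.sum_pi_single', Finset.mem_univ,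
      if_true]
    simpa using hα
  · simp
  · rintro x y _ _ ⟨h1, h2⟩ ⟨h3, h4⟩
    rw [map_add]
    exact ⟨add_mem h1 h3, add_mem h2 h4⟩
  · rintro r x _ ⟨h1, h2⟩
    refine ⟨Submodule.smul_mem _ _ h1, ?_⟩
    rw [Algebra.smul_def, Derivation.leibniz, hD, smul_eq_mul, smul_eq_mul, mul_comm x,
      ← Algebra.smul_def, ← Algebra.smul_def]
    exact add_mem (Submodule.smul_mem _ _ h2) (Submodule.smul_mem _ _ (FFaux_mono n D p h1))

theorem le_FFaux (n : ℕ)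
    (D : Fin n → Derivation ℂ (Aloc n) (Aloc n))
    (hD : ∀ (i : Fin n) (r : MvPolynomial (Fin n) ℂ),
      D i (algebraMap (MvPolynomial (Fin n) ℂ) (Aloc n) r) =
        algebraMap (MvPolynomial (Fin n) ℂ) (Aloc n) (pderiv i r)) (hn : 2 ≤ n) (p : ℕ) : MMaux n p ≤ FFaux n D p := by
  induction p with
  | zero =>
    intro a ha
    obtain ⟨g, -, rfl⟩ := (mem_MMaux n 0 a).1 ha
    rw [← Algebra.smul_def]
    refine Submodule.smul_mem _ _ (Submodule.subset_span ⟨0, by simp, ?_⟩)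
    have : ∀ l : List (Fin n), l.foldr (fun i x => (⇑(D i))^[(0 : Fin n → ℕ) i] x)
        (hinv n ^ (n / 2)) = hinv n ^ (n / 2) := by
      intro l
      induction l with
      | nil => rfl
      | cons j l ih => rw [List.foldr_cons, ih]; rfl
    rw [this, Nat.add_zero]
  | succ p ih =>
    unfold MMaux
    rw [Submodule.map_le_iff_le_comap]
    refine poly_aux n hn p _ ?_
    intro i g hg
    rw [Submodule.mem_comap, LinearMap.toSpanSingleton_apply, Algebra.smul_def, ← Nat.add_assoc,
      ← deriv_aux n D hD]
    exact deriv_FFaux n D hD i p _ (ih ((mem_MMaux n p _).2 ⟨g, hg, rfl⟩))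

/-- The computation (1.5.2) in the proof of Lemma 1.5: for `h = x_1² + ⋯ + x_n²` and
`m = ⌊n/2⌋`, the `ℂ[x_1,…,x_n]`-submodule of `ℂ[x_1,…,x_n][h⁻¹]` generated by the
elements `D^α(h^{−m})` with `|α| ≤ p` (where the `D_i` are the derivations extending the
partial derivatives) is exactly `{ g·h^{−m−p} : g ∈ 𝔪^p }` with `𝔪 = (x_1,…,x_n)`. -/
theorem stmt5 (n : ℕ) (hn : 2 ≤ n)
    (D : Fin n → Derivation ℂ (Aloc n) (Aloc n))
    (hD : ∀ (i : Fin n) (r : MvPolynomial (Fin n) ℂ),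
      D i (algebraMap (MvPolynomial (Fin n) ℂ) (Aloc n) r) =
        algebraMap (MvPolynomial (Fin n) ℂ) (Aloc n) (pderiv i r))
    (p : ℕ) :
    (Submodule.span (MvPolynomial (Fin n) ℂ)
        { a : Aloc n | ∃ α : Fin n → ℕ, (∑ i, α i) ≤ p ∧
          a = (List.finRange n).foldr (fun i x => (⇑(D i))^[α i] x) (hinv n ^ (n / 2)) } :
      Set (Aloc n)) =
    { a : Aloc n | ∃ g ∈ Ideal.span (Set.range X : Set (MvPolynomial (Fin n) ℂ)) ^ p,
      a = algebraMap (MvPolynomial (Fin n) ℂ) (Aloc n) g * hinv n ^ (n / 2 + p) } := by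
  ext a
  have : FFaux n D p = MMaux n p := le_antisymm (FFaux_le n D hD p) (le_FFaux n D hD hn p)
  change a ∈ FFaux n D p ↔ _
  rw [this]
  exact mem_MMaux n p a
end

section
/- Let f = xyz(x+y+z) ∈ ℂ[x,y,z] and let S be the six points (1,0,0), (0,1,0), (0,0,1), (1,−1,0), (1,0,−1), (0,1,−1) of ℂ³. Then: (a) f and all three first-order partial derivatives of f vanish at every point of S (so each point of S is a singular point of the quartic curve {f = 0} ⊂ ℙ²); (b) the only homogeneous polynomial of degree 1 vanishing at all six points is 0, and the only homogeneous polynomial of degree 2 vanishing at all six points is 0; consequently, if I denotes the ideal generated by all homogeneous polynomials vanishing at every point of S, then (I²)_4 = 0; (c) hence f is a nonzero element of I^{(2)}_4 and I^{(2)}_4 ≠ (I²)_4. -/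
open MvPolynomial

lemma eval_hom {n : ℕ} {g : MvPolynomial (Fin 3) ℂ} (hg : g.IsHomogeneous n)
    (T : Finset (Fin 3 → ℕ)) (hT : ∀ d : Fin 3 → ℕ, d 0 + d 1 + d 2 = n → d ∈ T) (y : Fin 3 → ℂ) :
    eval y g = ∑ d ∈ T, coeff (Finsupp.equivFunOnFinite.symm d) g *
      (y 0 ^ d 0 * y 1 ^ d 1 * y 2 ^ d 2) := by
  rw [eval_eq']
  have : g.support ⊆ T.map Finsupp.equivFunOnFinite.symm.toEmbedding := by
    intro d hd
    have h := hg (mem_support_iff.mp hd)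
    rw [Finset.mem_map]
    refine ⟨d, hT _ ?_, by simp⟩
    rw [← h, Finsupp.weight_apply, Finsupp.sum_fintype _ _ (by simp), Fin.sum_univ_three]
    simp
  rw [Finset.sum_subset this (by
    intro d _ hd
    rw [notMem_support_iff.mp hd, zero_mul]), Finset.sum_map]
  simp [Fin.prod_univ_three]

lemma hom_zero {n : ℕ} {g : MvPolynomial (Fin 3) ℂ} (hg : g.IsHomogeneous n)
    (T : Finset (Fin 3 → ℕ)) (hT : ∀ d : Fin 3 → ℕ, d 0 + d 1 + d 2 = n → d ∈ T)
    (h : ∀ d ∈ T, coeff (Finsupp.equivFunOnFinite.symm d) g = 0) : g = 0 := by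
  ext d
  rw [coeff_zero]
  by_contra hd
  have h1 := hg hd
  apply hd
  have := h d (hT _ (by
    rw [← h1, Finsupp.weight_apply, Finsupp.sum_fintype _ _ (by simp), Fin.sum_univ_three]
    simp))
  simpa using this

lemma deg_one (g : MvPolynomial (Fin 3) ℂ) (hg : g.IsHomogeneous 1)
    (h0 : eval ![1, 0, 0] g = 0) (h1 : eval ![0, 1, 0] g = 0) (h2 : eval ![0, 0, 1] g = 0) :
    g = 0 := by
  have hT : ∀ d : Fin 3 → ℕ, d 0 + d 1 + d 2 = 1 →
      d ∈ ({![1,0,0], ![0,1,0], ![0,0,1]} : Finset (Fin 3 → ℕ)) := by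
    intro d hd
    simp only [Finset.mem_insert, Finset.mem_singleton, funext_iff, Fin.forall_fin_succ]
    simp
    omega
  apply hom_zero hg _ hT
  rw [eval_hom hg _ hT] at h0 h1 h2
  simp at h0 h1 h2
  simp [*]

lemma deg_two (g : MvPolynomial (Fin 3) ℂ) (hg : g.IsHomogeneous 2)
    (h0 : eval ![1, 0, 0] g = 0) (h1 : eval ![0, 1, 0] g = 0) (h2 : eval ![0, 0, 1] g = 0)
    (h3 : eval ![1, -1, 0] g = 0) (h4 : eval ![1, 0, -1] g = 0) (h5 : eval ![0, 1, -1] g = 0) :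
    g = 0 := by
  have hT : ∀ d : Fin 3 → ℕ, d 0 + d 1 + d 2 = 2 →
      d ∈ ({![2,0,0], ![0,2,0], ![0,0,2], ![1,1,0], ![1,0,1], ![0,1,1]} :
        Finset (Fin 3 → ℕ)) := by
    intro d hd
    simp only [Finset.mem_insert, Finset.mem_singleton, funext_iff, Fin.forall_fin_succ]
    simp
    omega
  apply hom_zero hg _ hT
  rw [eval_hom hg _ hT] at h0 h1 h2 h3 h4 h5
  simp at h0 h1 h2 h3 h4 h5
  simp [h0, h1, h2] at h3 h4 h5
  simp [*]

/-- The example in (2.3): for `f = xyz(x+y+z)` with its six singular points, one has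
`f ∈ I^{(2)}_4` while `(I²)_4 = 0`, so `I^{(2)}_4 ≠ (I²)_4`. -/
theorem stmt9 :
    let f : MvPolynomial (Fin 3) ℂ := X 0 * X 1 * X 2 * (X 0 + X 1 + X 2)
    let pts : Fin 6 → Fin 3 → ℂ :=
      ![![1, 0, 0], ![0, 1, 0], ![0, 0, 1], ![1, -1, 0], ![1, 0, -1], ![0, 1, -1]]
    let I : Ideal (MvPolynomial (Fin 3) ℂ) :=
      Ideal.span { g | (∃ k, g.IsHomogeneous k) ∧ ∀ p, eval (pts p) g = 0 }
    -- (a) each point of `pts` is a singular point of the quartic `{f = 0}`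
    (∀ p, eval (pts p) f = 0) ∧
    (∀ p, ∀ j, eval (pts p) (pderiv j f) = 0) ∧
    -- (b) no nonzero homogeneous polynomial of degree 1 or 2 vanishes at all six points,
    -- and consequently `(I²)_4 = 0`
    (∀ g : MvPolynomial (Fin 3) ℂ, g.IsHomogeneous 1 → (∀ p, eval (pts p) g = 0) → g = 0) ∧
    (∀ g : MvPolynomial (Fin 3) ℂ, g.IsHomogeneous 2 → (∀ p, eval (pts p) g = 0) → g = 0) ∧
    (∀ g ∈ I ^ 2, g.IsHomogeneous 4 → g = 0) ∧
    -- (c) `f` is a nonzero element of `I^{(2)}_4`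
    f ≠ 0 ∧ f.IsHomogeneous 4 ∧ (∀ p, vOrd 2 (pts p) f) := by
  intro f pts I
  have ha : ∀ p, eval (pts p) f = 0 := by
    intro p
    fin_cases p <;> simp [f, pts]
  have hb : ∀ p, ∀ j, eval (pts p) (pderiv j f) = 0 := by
    intro p j
    fin_cases p <;> fin_cases j <;> simp [f, pts, pderiv_X, Derivation.leibniz]
  have h1 : ∀ g : MvPolynomial (Fin 3) ℂ, g.IsHomogeneous 1 → (∀ p, eval (pts p) g = 0) → g = 0 :=
    fun g hg h => deg_one g hg (h 0) (h 1) (h 2)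
  have h2 : ∀ g : MvPolynomial (Fin 3) ℂ, g.IsHomogeneous 2 → (∀ p, eval (pts p) g = 0) → g = 0 :=
    fun g hg h => deg_two g hg (h 0) (h 1) (h 2) (h 3) (h 4) (h 5)
  refine ⟨ha, hb, h1, h2, ?_, ?_, ?_, ?_⟩
  · have hI : I ≤ idealOfVars (Fin 3) ℂ ^ 3 := by
      refine Ideal.span_le.mpr ?_
      rintro g ⟨⟨k, hk⟩, hg⟩
      by_cases h3 : 3 ≤ k
      · refine (mem_pow_idealOfVars_iff 3 g).mpr fun x hx => ?_
        have := hk.degree_eq_sum_deg_support hx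
        rw [← Finsupp.degree_apply] at this
        omega
      · have hg0 : g = 0 := by
          have : k = 0 ∨ k = 1 ∨ k = 2 := by omega
          rcases this with rfl | rfl | rfl
          · have h := hg 0
            rw [totalDegree_eq_zero_iff_eq_C.mp (Nat.le_zero.mp hk.totalDegree_le), eval_C] at h
            rw [totalDegree_eq_zero_iff_eq_C.mp (Nat.le_zero.mp hk.totalDegree_le), h, C_0]
          · exact h1 g hk hg
          · exact h2 g hk hg
        rw [hg0]
        exact zero_mem _
    intro g hg hg4
    have hm := Ideal.pow_right_mono hI 2 hg
    rw [← pow_mul] at hm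
    have hm' := (mem_pow_idealOfVars_iff _ g).mp hm
    rw [← support_eq_empty, Finset.eq_empty_iff_forall_notMem]
    intro x hx
    have a := hm' x hx
    have b := hg4.degree_eq_sum_deg_support hx
    rw [← Finsupp.degree_apply] at b
    omega
  · intro h
    have := congrArg (eval ![1, 1, 1]) h
    simp [f] at this
    norm_num at this
  · exact (((isHomogeneous_X ℂ 0).mul (isHomogeneous_X ℂ 1)).mul (isHomogeneous_X ℂ 2)).mul
      (((isHomogeneous_X ℂ 0).add (isHomogeneous_X ℂ 1)).add (isHomogeneous_X ℂ 2))
  · intro p μ hμ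
    rw [Fin.sum_univ_three] at hμ
    have : (μ 0 = 0 ∧ μ 1 = 0 ∧ μ 2 = 0) ∨ (μ 0 = 1 ∧ μ 1 = 0 ∧ μ 2 = 0) ∨
      (μ 0 = 0 ∧ μ 1 = 1 ∧ μ 2 = 0) ∨ (μ 0 = 0 ∧ μ 1 = 0 ∧ μ 2 = 1) := by omega
    have e : pd μ f = (pderiv 0)^[μ 0] ((pderiv 1)^[μ 1] ((pderiv 2)^[μ 2] f)) := rfl
    rw [e]
    rcases this with ⟨a, b, c⟩ | ⟨a, b, c⟩ | ⟨a, b, c⟩ | ⟨a, b, c⟩ <;>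
      simp only [a, b, c, Function.iterate_zero, Function.iterate_one, id]
    exacts [ha p, hb p 0, hb p 1, hb p 2]
end

section
/- Let n ≥ 2 and h = z_1² + ⋯ + z_n² ∈ ℂ[z_1,…,z_n]. Suppose a_1, …, a_n ∈ ℂ[z_1,…,z_n] satisfy z_i a_j = z_j a_i for all i, j (i.e. dh ∧ η = 0 for η = Σ a_i dz_i) and ∂a_j/∂z_i = ∂a_i/∂z_j for all i, j (i.e. dη = 0). Then there exists a one-variable polynomial Q ∈ ℂ[t] such that a_i = z_i · Q(h) for every i. -/
open MvPolynomial

theorem aux_pderiv_comm {σ : Type*} (i j : σ) (p : MvPolynomial σ ℂ) :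
    pderiv i (pderiv j p) = pderiv j (pderiv i p) := by
  classical
  ext m
  simp only [coeff_pderiv]
  rw [add_right_comm m (Finsupp.single j 1) (Finsupp.single i 1)]
  by_cases hij : i = j
  · subst hij; rfl
  · have hji : j ≠ i := fun h => hij h.symm
    simp only [Finsupp.add_apply, Finsupp.single_eq_of_ne hij, Finsupp.single_eq_of_ne hji,
      add_zero]
    ring

theorem aux_deg {σ : Type*} (i : σ) (p : MvPolynomial σ ℂ) :
    (pderiv i p).totalDegree ≤ p.totalDegree := by
  classical
  rw [totalDegree, Finset.sup_le_iff]
  intro m hm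
  rw [mem_support_iff, coeff_pderiv] at hm
  have h := le_totalDegree (mem_support_iff.mpr (left_ne_zero_of_mul hm))
  rw [Finsupp.sum_add_index' (by simp) (by simp)] at h
  omega

theorem aux_const {σ : Type*} (p : MvPolynomial σ ℂ) (h : ∀ i, pderiv i p = 0) :
    p = C (coeff 0 p) := by
  classical
  ext m
  rw [coeff_C]
  split_ifs with hm
  · rw [hm]
  · obtain ⟨i, hi⟩ : ∃ i, m i ≠ 0 := by
      by_contra! hc
      exact hm (by ext i; simp [hc])
    have h' := congrArg (coeff (m - Finsupp.single i 1)) (h i)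
    rw [coeff_pderiv, tsub_add_cancel_of_le
      (Finsupp.single_le_iff.mpr (Nat.one_le_iff_ne_zero.mpr hi)), coeff_zero] at h'
    exact (mul_eq_zero.mp h').resolve_right (Nat.cast_add_one_ne_zero _)

theorem aux_anti (Q : Polynomial ℂ) : ∃ P : Polynomial ℂ, 2 * Polynomial.derivative P = Q := by
  induction Q using Polynomial.induction_on' with
  | add p q hp hq =>
    obtain ⟨P, rfl⟩ := hp
    obtain ⟨P', rfl⟩ := hq
    exact ⟨P + P', by simp [mul_add]⟩
  | monomial k c =>
    refine ⟨Polynomial.monomial (k + 1) (c / (2 * (k + 1))), ?_⟩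
    have : (k : ℂ) + 1 ≠ 0 := Nat.cast_add_one_ne_zero _
    rw [Polynomial.derivative_monomial, two_mul, ← map_add]
    simp only [Nat.add_sub_cancel]
    congr 1
    push_cast
    field_simp
    ring

theorem aux_main (n : ℕ) (hn : 2 ≤ n) (N : ℕ) : ∀ (a : Fin n → MvPolynomial (Fin n) ℂ)
    (_ : ∀ i, (a i).totalDegree < N)
    (_ : ∀ i j, X i * a j = X j * a i)
    (_ : ∀ i j, pderiv i (a j) = pderiv j (a i)),
    ∃ Q : Polynomial ℂ, ∀ i,
      a i = X i * Polynomial.aeval (∑ l, X l ^ 2 : MvPolynomial (Fin n) ℂ) Q := by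
  let z : Fin n := ⟨0, by omega⟩
  let w : Fin n := ⟨1, by omega⟩
  have hzw : z ≠ w := by simp [z, w]
  induction N with
  | zero => intro a h; exact absurd (h z) (by omega)
  | succ N ih =>
    intro a hN h1 h2
    have hd : (X z : MvPolynomial (Fin n) ℂ) ∣ X w * a z := ⟨a w, (h1 z w).symm⟩
    rw [X_dvd_mul_iff, X_dvd_X] at hd
    obtain ⟨b, hb⟩ := hd.resolve_left hzw
    have hab : ∀ i, a i = X i * b := by
      intro i
      apply mul_left_cancel₀ (X_ne_zero z)
      rw [h1 z i, hb]; ring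
    by_cases hb0 : b = 0
    · exact ⟨0, fun i => by simp [hab, hb0]⟩
    have hbN : b.totalDegree < N := by
      have := hN z
      rw [hb, totalDegree_mul_of_isDomain (X_ne_zero z) hb0, totalDegree_X] at this
      omega
    obtain ⟨Q, hQ⟩ := ih (fun i => pderiv i b) (fun i => (aux_deg i b).trans_lt hbN) (by
      intro i j
      by_cases hij : i = j
      · rw [hij]
      have h := h2 i j
      rw [hab, hab, pderiv_mul, pderiv_mul, pderiv_X_of_ne (Ne.symm hij), pderiv_X_of_ne hij] at h
      simpa using h.symm) (fun i j => aux_pderiv_comm i j b)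
    obtain ⟨P, rfl⟩ := aux_anti Q
    set s : MvPolynomial (Fin n) ℂ := ∑ l, X l ^ 2 with hs
    have hds : ∀ i, pderiv i s = 2 * X i := by
      intro i
      rw [hs, map_sum, Finset.sum_eq_single i]
      · simp
      · intro j _ hj
        simp [pderiv_X_of_ne hj]
      · simp
    have hc := aux_const (b - Polynomial.aeval s P) (by
      intro i
      rw [map_sub, Derivation.map_aeval, hds, hQ i, map_mul]
      simp only [map_ofNat, smul_eq_mul]
      ring)
    refine ⟨P + Polynomial.C (coeff 0 (b - Polynomial.aeval s P)), fun i => ?_⟩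
    rw [hab, map_add, Polynomial.aeval_C, algebraMap_eq, ← hc]
    ring

/-- Claim (4.1.5): for `h = z_1² + ⋯ + z_n²`, a polynomial 1-form `η = Σ a_i dz_i`
which is closed (`∂a_j/∂z_i = ∂a_i/∂z_j`) and annihilated by `dh ∧` (`z_i a_j = z_j a_i`)
is of the form `Q(h)·dh/2`, i.e. `a_i = z_i · Q(h)` for a one-variable polynomial `Q`. -/
theorem stmt12 (n : ℕ) (hn : 2 ≤ n) (a : Fin n → MvPolynomial (Fin n) ℂ)
    (h1 : ∀ i j, X i * a j = X j * a i)
    (h2 : ∀ i j, pderiv i (a j) = pderiv j (a i)) :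
    ∃ Q : Polynomial ℂ, ∀ i,
      a i = X i * Polynomial.aeval (∑ l, X l ^ 2 : MvPolynomial (Fin n) ℂ) Q := by
  refine aux_main n hn (Finset.univ.sup (fun i => (a i).totalDegree) + 1) a (fun i => ?_) h1 h2
  exact Nat.lt_succ_of_le (Finset.le_sup (f := fun i => (a i).totalDegree) (Finset.mem_univ i))
end

section
/- Let n = 3 and f = Σ_{0 ≤ i < j ≤ 3} x_i² x_j² / 2 ∈ ℂ[x_0,x_1,x_2,x_3] (so ∂f/∂x_i = x_i Σ_{k ≠ i} x_k²). Then the set of nonzero vectors y ∈ ℂ⁴ at which all four partial derivatives of f vanish is exactly the set of nonzero scalar multiples of the four standard basis vectors e_0, e_1, e_2, e_3; and at each e_i the Hessian matrix (∂²f/∂x_j∂x_k(e_i)) has rank 3. In other words, the quartic surface Y = {f = 0} ⊂ ℙ³(ℂ) has exactly four singular points, the four coordinate points, and each is an ordinary double point. -/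
open MvPolynomial

set_option maxHeartbeats 4000000

theorem pd_aux (j : Fin 4) : pderiv j (C ((2 : ℂ)⁻¹) *
      (X 0 ^ 2 * X 1 ^ 2 + X 0 ^ 2 * X 2 ^ 2 + X 0 ^ 2 * X 3 ^ 2 +
        X 1 ^ 2 * X 2 ^ 2 + X 1 ^ 2 * X 3 ^ 2 + X 2 ^ 2 * X 3 ^ 2) : MvPolynomial (Fin 4) ℂ)
    = X j * (X 0 ^ 2 + X 1 ^ 2 + X 2 ^ 2 + X 3 ^ 2 - X j ^ 2) := by
  have h : (C ((2 : ℂ)⁻¹) : MvPolynomial (Fin 4) ℂ) * 2 = 1 := by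
    rw [show (2 : MvPolynomial (Fin 4) ℂ) = C 2 from rfl, ← C_mul]
    norm_num
  fin_cases j
  · simp [pderiv_X, Derivation.leibniz_pow]
    linear_combination (X 0 * (X 1 ^ 2 + X 2 ^ 2 + X 3 ^ 2)) * h
  · simp [pderiv_X, Derivation.leibniz_pow]
    linear_combination (X 1 * (X 0 ^ 2 + X 2 ^ 2 + X 3 ^ 2)) * h
  · simp [pderiv_X, Derivation.leibniz_pow]
    linear_combination (X 2 * (X 1 ^ 2 + X 0 ^ 2 + X 3 ^ 2)) * h
  · simp [pderiv_X, Derivation.leibniz_pow]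
    linear_combination (X 3 * (X 1 ^ 2 + X 2 ^ 2 + X 0 ^ 2)) * h

/-- The example (3.8)(ii): the quartic surface `{Σ_{i<j} x_i²x_j²/2 = 0} ⊂ ℙ³` has
exactly four singular points, the four coordinate points (the common zeros of the
partials are exactly the nonzero multiples of the standard basis vectors), and each is
an ordinary double point (Hessian of rank 3). -/
theorem stmt15 :
    let f : MvPolynomial (Fin 4) ℂ := C ((2 : ℂ)⁻¹) *
      (X 0 ^ 2 * X 1 ^ 2 + X 0 ^ 2 * X 2 ^ 2 + X 0 ^ 2 * X 3 ^ 2 +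
        X 1 ^ 2 * X 2 ^ 2 + X 1 ^ 2 * X 3 ^ 2 + X 2 ^ 2 * X 3 ^ 2)
    let e : Fin 4 → Fin 4 → ℂ := fun i l => if l = i then 1 else 0
    ({ y : Fin 4 → ℂ | y ≠ 0 ∧ ∀ j, eval y (pderiv j f) = 0 } =
      { y : Fin 4 → ℂ | ∃ c : ℂ, c ≠ 0 ∧ ∃ i : Fin 4, y = c • e i }) ∧
    ∀ i : Fin 4, (hess f (e i)).rank = 3 := by
  intro f e
  have hf : ∀ j, pderiv j f = X j * (X 0 ^ 2 + X 1 ^ 2 + X 2 ^ 2 + X 3 ^ 2 - X j ^ 2) := pd_aux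
  refine ⟨?_, ?_⟩
  · ext y
    simp only [Set.mem_ofPred_eq, hf]
    constructor
    · rintro ⟨hy, h⟩
      obtain ⟨i, hi⟩ := Function.ne_iff.mp hy
      simp only [Pi.zero_apply] at hi
      have key : ∀ j, y j = 0 ∨ y j ^ 2 = y 0 ^ 2 + y 1 ^ 2 + y 2 ^ 2 + y 3 ^ 2 := by
        intro j
        have := h j
        simp only [map_mul, map_sub, map_add, map_pow, eval_X, mul_eq_zero] at this
        rcases this with h | h
        · exact Or.inl h
        · exact Or.inr (by linear_combination -h)
      refine ⟨y i, hi, i, ?_⟩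
      have hi2 : y i ^ 2 ≠ 0 := pow_ne_zero 2 hi
      have main : ∀ j, j ≠ i → y j = 0 := by
        have k0 := key 0
        have k1 := key 1
        have k2 := key 2
        have k3 := key 3
        clear h key hy hf
        intro j hj
        by_contra hc
        have hc2 : y j ^ 2 ≠ 0 := pow_ne_zero 2 hc
        fin_cases i <;> fin_cases j <;> simp at hi hi2 hc hc2 hj <;> grind
      funext l
      by_cases hl : l = i
      · simp [e, hl]
      · simp [e, hl, main l hl]
    · rintro ⟨c, hc, i, rfl⟩
      refine ⟨?_, ?_⟩
      · intro h0
        have := congrFun h0 i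
        simp [e] at this
        exact hc this
      · intro j
        fin_cases i <;> fin_cases j <;> simp [e]
  · intro i
    have hd : hess f (e i) = Matrix.diagonal (fun j => if j = i then (0 : ℂ) else 1) := by
      ext a b
      simp only [hess, Matrix.of_apply, hf, Matrix.diagonal_apply]
      fin_cases i <;> fin_cases a <;> fin_cases b <;>
        simp [e, pderiv_X, Derivation.leibniz_pow]
    rw [hd, Matrix.rank_diagonal]
    fin_cases i <;> simp [Fintype.card_subtype] <;> decide
end

section
/- Let f = Σ_{i=0}^3 x_i⁴ − Σ_{0 ≤ i < j ≤ 3} x_i² x_j² ∈ ℂ[x_0,x_1,x_2,x_3] (so ∂f/∂x_j = 2x_j(2x_j² − Σ_{i ≠ j} x_i²)). Then the singular points of the quartic surface Y = {f = 0} ⊂ ℙ³(ℂ) are exactly the projective classes of the vectors v ∈ {0, 1, −1}⁴ having exactly one coordinate equal to 0 (and the other three equal to ±1); there are exactly 16 such projective classes, and each of these singular points is an ordinary double point. -/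
open MvPolynomial

/-- Integer representatives of the sixteen nodes. -/
def nodeZ : Fin 16 → Fin 4 → ℤ :=
  ![![0, 1, 1, 1], ![0, 1, 1, -1], ![0, 1, -1, 1], ![0, 1, -1, -1],
    ![1, 0, 1, 1], ![1, 0, 1, -1], ![1, 0, -1, 1], ![1, 0, -1, -1],
    ![1, 1, 0, 1], ![1, 1, 0, -1], ![1, -1, 0, 1], ![1, -1, 0, -1],
    ![1, 1, 1, 0], ![1, 1, -1, 0], ![1, -1, 1, 0], ![1, -1, -1, 0]]

theorem nodeZ_inj : ∀ a b : Fin 16,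
    (∀ i j, nodeZ a i * nodeZ b j = nodeZ a j * nodeZ b i) → a = b := by
  decide +kernel

theorem nodeZ_P : ∀ a : Fin 16,
    (∀ i, nodeZ a i = 0 ∨ nodeZ a i = 1 ∨ nodeZ a i = -1) ∧
      ∃ i, nodeZ a i = 0 ∧ ∀ j, nodeZ a j = 0 → j = i := by
  decide +kernel

theorem nodeZ_cover : ∀ a b c d : SignType,
    (a : ℤ) ^ 2 + (b : ℤ) ^ 2 + (c : ℤ) ^ 2 + (d : ℤ) ^ 2 = 3 →
    ∃ n : Fin 16, (∀ i, (![a, b, c, d] i : ℤ) = nodeZ n i) ∨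
      (∀ i, (![a, b, c, d] i : ℤ) = - nodeZ n i) := by
  decide +kernel

theorem sign_unique_iff : ∀ a b c d : SignType,
    (∃ i, ![a, b, c, d] i = 0 ∧ ∀ j, ![a, b, c, d] j = 0 → j = i) ↔
    (a : ℤ) ^ 2 + (b : ℤ) ^ 2 + (c : ℤ) ^ 2 + (d : ℤ) ^ 2 = 3 := by
  decide +kernel

theorem exists_sign (v : Fin 4 → ℂ) (h : ∀ i, v i = 0 ∨ v i = 1 ∨ v i = -1) :
    ∃ a b c d : SignType, ∀ i, v i = ((![a, b, c, d] i : ℤ) : ℂ) := by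
  have key : ∀ i, ∃ s : SignType, v i = ((s : ℤ) : ℂ) := by
    intro i
    rcases h i with h | h | h
    · exact ⟨0, by simp [h]⟩
    · exact ⟨1, by simp [h]⟩
    · exact ⟨-1, by simp [h]⟩
  choose s hs using key
  refine ⟨s 0, s 1, s 2, s 3, ?_⟩
  intro i
  rw [hs i]
  fin_cases i <;> rfl

theorem unique_iff_sum (v : Fin 4 → ℂ) (h : ∀ i, v i = 0 ∨ v i = 1 ∨ v i = -1) :
    (∃! i, v i = 0) ↔ v 0 ^ 2 + v 1 ^ 2 + v 2 ^ 2 + v 3 ^ 2 = 3 := by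
  obtain ⟨a, b, c, d, hs⟩ := exists_sign v h
  have hz : ∀ s : SignType, (s : ℤ) = 0 ↔ s = 0 := by decide
  have h1 : ∀ i, v i = 0 ↔ ![a, b, c, d] i = 0 := by
    intro i
    rw [hs i, Int.cast_eq_zero, hz]
  have h2 : (∃! i, v i = 0) ↔
      (∃ i, ![a, b, c, d] i = 0 ∧ ∀ j, ![a, b, c, d] j = 0 → j = i) := by
    simp only [ExistsUnique, h1]
  rw [h2, sign_unique_iff, hs 0, hs 1, hs 2, hs 3]
  exact_mod_cast Iff.rfl

/-- The quartic. -/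
noncomputable def quartic : MvPolynomial (Fin 4) ℂ :=
  (X 0 ^ 4 + X 1 ^ 4 + X 2 ^ 4 + X 3 ^ 4) -
        (X 0 ^ 2 * X 1 ^ 2 + X 0 ^ 2 * X 2 ^ 2 + X 0 ^ 2 * X 3 ^ 2 +
          X 1 ^ 2 * X 2 ^ 2 + X 1 ^ 2 * X 3 ^ 2 + X 2 ^ 2 * X 3 ^ 2)

theorem pderiv_quartic (j : Fin 4) : pderiv j quartic =
    6 * X j ^ 3 - 2 * X j * (X 0 ^ 2 + X 1 ^ 2 + X 2 ^ 2 + X 3 ^ 2) := by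
  unfold quartic
  fin_cases j <;>
  · simp [pderiv_X, Derivation.leibniz_pow, Derivation.leibniz]
    ring

theorem hess_quartic (y : Fin 4 → ℂ) (i j : Fin 4) : hess quartic y i j =
    (if i = j then 18 * y j ^ 2 - 2 * (y 0 ^ 2 + y 1 ^ 2 + y 2 ^ 2 + y 3 ^ 2) else 0)
      - 4 * y i * y j := by
  have h2 : ∀ i : Fin 4, pderiv i (2 : MvPolynomial (Fin 4) ℂ) = 0 := fun i =>
    (pderiv i).map_natCast 2
  have h6 : ∀ i : Fin 4, pderiv i (6 : MvPolynomial (Fin 4) ℂ) = 0 := fun i =>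
    (pderiv i).map_natCast 6
  simp only [hess, Matrix.of_apply, pderiv_quartic]
  fin_cases i <;> fin_cases j <;>
  · simp [pderiv_X, Derivation.leibniz_pow, Derivation.leibniz, h2, h6]
    try ring

theorem rank_hess (v : Fin 4 → ℂ) (h : ∀ i, v i = 0 ∨ v i = 1 ∨ v i = -1)
    (hS : v 0 ^ 2 + v 1 ^ 2 + v 2 ^ 2 + v 3 ^ 2 = 3) : (hess quartic v).rank = 3 := by
  have hmul : ∀ w j, (hess quartic v).mulVec w j = (18 * v j ^ 2 - 6) * w j
      - 4 * v j * (v 0 * w 0 + v 1 * w 1 + v 2 * w 2 + v 3 * w 3) := by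
    intro w j
    simp only [Matrix.mulVec, dotProduct, Fin.sum_univ_four, hess_quartic, hS]
    fin_cases j <;> simp <;> ring
  have hv0 : v ≠ 0 := by
    rintro rfl
    norm_num at hS
  have hker : LinearMap.ker (hess quartic v).mulVecLin = Submodule.span ℂ {v} := by
    ext w
    rw [LinearMap.mem_ker, Matrix.mulVecLin_apply, Submodule.mem_span_singleton]
    constructor
    · intro hw
      refine ⟨(v 0 * w 0 + v 1 * w 1 + v 2 * w 2 + v 3 * w 3) / 3, ?_⟩
      ext j
      have := congrFun hw j
      rw [hmul] at this
      simp only [Pi.zero_apply] at this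
      simp only [Pi.smul_apply, smul_eq_mul]
      rcases h j with h | h | h <;> rw [h] at this ⊢
      · linear_combination (1 / 6) * this
      · linear_combination (-1 / 12) * this
      · linear_combination (-1 / 12) * this
    · rintro ⟨c, rfl⟩
      ext j
      rw [hmul]
      simp only [Pi.smul_apply, smul_eq_mul, Pi.zero_apply]
      have e : v 0 * (c * v 0) + v 1 * (c * v 1) + v 2 * (c * v 2) + v 3 * (c * v 3) = 3 * c := by
        linear_combination c * hS
      rw [e]
      rcases h j with h | h | h <;> rw [h] <;> ring
  have hrn := LinearMap.finrank_range_add_finrank_ker (hess quartic v).mulVecLin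
  rw [hker, finrank_span_singleton hv0] at hrn
  simp only [Module.finrank_fintype_fun_eq_card, Fintype.card_fin] at hrn
  unfold Matrix.rank
  omega

theorem sing_iff (y : Fin 4 → ℂ) (hy : y ≠ 0) :
    (∀ j, eval y (pderiv j quartic) = 0) ↔
      ∃ c : ℂ, c ≠ 0 ∧ ∃ v : Fin 4 → ℂ,
        ((∀ i, v i = 0 ∨ v i = 1 ∨ v i = -1) ∧ (∃! i, v i = 0)) ∧ y = c • v := by
  have he : ∀ j, eval y (pderiv j quartic) =
      6 * y j ^ 3 - 2 * y j * (y 0 ^ 2 + y 1 ^ 2 + y 2 ^ 2 + y 3 ^ 2) := by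
    intro j
    rw [pderiv_quartic]
    simp
  simp only [he]
  constructor
  · intro h
    obtain ⟨k, hk⟩ := Function.ne_iff.mp hy
    simp only [Pi.zero_apply] at hk
    have hsq : ∀ j, y j ≠ 0 → y 0 ^ 2 + y 1 ^ 2 + y 2 ^ 2 + y 3 ^ 2 = 3 * y j ^ 2 := by
      intro j hj
      apply mul_left_cancel₀ hj
      linear_combination (-1 / 2) * h j
    have hv : ∀ i, y i / y k = 0 ∨ y i / y k = 1 ∨ y i / y k = -1 := by
      intro i
      by_cases hi : y i = 0
      · left; simp [hi]
      · right
        have e : y i ^ 2 = y k ^ 2 := by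
          linear_combination (1 / 3) * hsq k hk - (1 / 3) * hsq i hi
        apply eq_or_eq_neg_of_sq_eq_sq
        rw [one_pow]
        rw [div_pow, e, div_self (pow_ne_zero 2 hk)]
    refine ⟨y k, hk, fun i => y i / y k, ⟨hv, ?_⟩, ?_⟩
    · rw [unique_iff_sum _ hv]
      have := hsq k hk
      field_simp
      linear_combination this
    · ext i
      simp [mul_div_cancel₀ _ hk]
  · rintro ⟨c, hc, v, ⟨hv, hu⟩, rfl⟩ j
    rw [unique_iff_sum v hv] at hu
    simp only [Pi.smul_apply, smul_eq_mul]
    have e : (c * v 0) ^ 2 + (c * v 1) ^ 2 + (c * v 2) ^ 2 + (c * v 3) ^ 2 = 3 * c ^ 2 := by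
      linear_combination c ^ 2 * hu
    rw [e]
    rcases hv j with h | h | h <;> rw [h] <;> ring

/-- Example (4.7)(ii): the singular points of the Kummer-type quartic
`{Σ x_i⁴ − Σ_{i<j} x_i²x_j² = 0} ⊂ ℙ³` are exactly the projective classes of the
vectors `v ∈ {0,1,−1}⁴` having exactly one coordinate `0`; there are exactly 16 such
projective classes, and each is an ordinary double point. -/
theorem stmt16 :
    let f : MvPolynomial (Fin 4) ℂ :=
      (X 0 ^ 4 + X 1 ^ 4 + X 2 ^ 4 + X 3 ^ 4) -
        (X 0 ^ 2 * X 1 ^ 2 + X 0 ^ 2 * X 2 ^ 2 + X 0 ^ 2 * X 3 ^ 2 +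
          X 1 ^ 2 * X 2 ^ 2 + X 1 ^ 2 * X 3 ^ 2 + X 2 ^ 2 * X 3 ^ 2)
    let P : (Fin 4 → ℂ) → Prop := fun v =>
      (∀ i, v i = 0 ∨ v i = 1 ∨ v i = -1) ∧ (∃! i, v i = 0)
    -- the singular points are exactly the classes of vectors satisfying `P`
    (∀ y : Fin 4 → ℂ, y ≠ 0 →
      ((∀ j, eval y (pderiv j f) = 0) ↔ ∃ c : ℂ, c ≠ 0 ∧ ∃ v, P v ∧ y = c • v)) ∧
    -- there are exactly 16 projective classes of such vectors
    (∃ vs : Fin 16 → (Fin 4 → ℂ), (∀ a, P (vs a)) ∧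
      (∀ a b, a ≠ b → ∀ c : ℂ, vs a ≠ c • vs b) ∧
      (∀ v, P v → ∃ a, ∃ c : ℂ, c ≠ 0 ∧ v = c • vs a)) ∧
    -- each of these singular points is an ordinary double point
    (∀ v, P v → (hess f v).rank = 3) := by
  intro f P
  refine ⟨fun y hy => sing_iff y hy, ?_, ?_⟩
  · refine ⟨fun a i => (nodeZ a i : ℂ), ?_, ?_, ?_⟩
    · intro a
      obtain ⟨h1, i, h2, h3⟩ := nodeZ_P a
      refine ⟨fun i => ?_, i, ?_, ?_⟩
      · rcases h1 i with h | h | h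
        · exact Or.inl (by simp [h])
        · exact Or.inr (Or.inl (by simp [h]))
        · exact Or.inr (Or.inr (by simp [h]))
      · simp [h2]
      · intro j hj
        exact h3 j (Int.cast_eq_zero.mp hj)
    · intro a b hab c h
      apply hab
      apply nodeZ_inj
      intro i j
      have hi := congrFun h i
      have hj := congrFun h j
      simp only [Pi.smul_apply, smul_eq_mul] at hi hj
      have : (nodeZ a i : ℂ) * nodeZ b j = nodeZ a j * nodeZ b i := by
        rw [hi, hj]; ring
      exact_mod_cast this
    · rintro v ⟨hv, hu⟩
      rw [unique_iff_sum v hv] at hu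
      obtain ⟨a, b, c, d, hs⟩ := exists_sign v hv
      rw [hs 0, hs 1, hs 2, hs 3] at hu
      obtain ⟨n, hn | hn⟩ := nodeZ_cover a b c d (by exact_mod_cast hu)
      · refine ⟨n, 1, one_ne_zero, ?_⟩
        ext i
        rw [hs i, hn i]
        simp
      · refine ⟨n, -1, by norm_num, ?_⟩
        ext i
        rw [hs i, hn i]
        simp
  · rintro v ⟨hv, hu⟩
    exact rank_hess v hv ((unique_iff_sum v hv).mp hu)
end
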